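/- arXiv:2404.08512 — 3 statements merged into one kernel-verified Lean document; each statement's English description precedes it below -/
import Mathlib

section
/- Assume T is an analytic full branch map with inverse branches φ_ℓ holomorphic on D_R and ⋃_ℓ φ_ℓ(D_R) ⊆ D_r, 1 < r < R. Let ρ ∈ (r, R) and set C = (ρ/√(ρ² − r²)) · sup_{z∈D_R} ∑_{ℓ=1}^d |φ_ℓ'(z)|. Then for every N ∈ ℕ₀ and every f holomorphic on D_ρ with ‖f‖_{H²(D_ρ)} < ∞: (i) 𝓛f is holomorphic on D_R and ‖𝓛f − 𝒫_N(𝓛f)‖_{H²(D_ρ)} ≤ C (ρ/R)^N ‖f‖_{H²(D_ρ)}; (ii) ‖𝓛f − 𝓛(𝒫_N f)‖_{H²(D_ρ)} ≤ C (r/ρ)^N ‖f‖_{H²(D_ρ)}; (iii) ‖𝓛f − 𝒫_N(𝓛(𝒫_N f))‖_{H²(D_ρ)} ≤ C ((ρ/R)^N + (r/ρ)^N) ‖f‖_{H²(D_ρ)}; and for the choice ρ = √(Rr) the bound in (iii) equals 2C (r/R)^{N/2} ‖f‖_{H²(D_ρ)}. -/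
open Metric

/-- The `n`-th Taylor coefficient of `f` at `0`. -/
noncomputable def taylorCoeff (f : ℂ → ℂ) (n : ℕ) : ℂ :=
  iteratedDeriv n f 0 / n.factorial

/-- The squared Hardy–Hilbert norm `‖f‖²_{H²(D_ρ)} = ∑ |f_n|² ρ^{2n}`. -/
noncomputable def H2normSq (ρ : ℝ) (f : ℂ → ℂ) : ℝ :=
  ∑' n : ℕ, ‖taylorCoeff f n‖ ^ 2 * ρ ^ (2 * n)

/-- The Hardy–Hilbert norm `‖f‖_{H²(D_ρ)}`. -/
noncomputable def H2norm (ρ : ℝ) (f : ℂ → ℂ) : ℝ :=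
  Real.sqrt (H2normSq ρ f)

/-- The Taylor projection `𝒫_N f = ∑_{n<N} f_n z^n`. -/
noncomputable def taylorProj (N : ℕ) (f : ℂ → ℂ) : ℂ → ℂ :=
  fun z => ∑ n ∈ Finset.range N, taylorCoeff f n * z ^ n

/-- The transfer operator `(𝓛f)(z) = ∑_ℓ σ_ℓ φ_ℓ'(z) f(φ_ℓ(z))`. -/
noncomputable def transferOp {d : ℕ} (σ : Fin d → ℂ) (φ : Fin d → ℂ → ℂ)
    (f : ℂ → ℂ) : ℂ → ℂ :=
  fun z => ∑ ℓ, σ ℓ * deriv (φ ℓ) z * f (φ ℓ z)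

open Filter Topology

section TaylorCoefficients

lemma hasSum_taylorCoeff {f : ℂ → ℂ} {ρ : ℝ} (hf : DifferentiableOn ℂ f (ball (0 : ℂ) ρ))
    {z : ℂ} (hz : z ∈ ball (0 : ℂ) ρ) : HasSum (fun n => taylorCoeff f n * z ^ n) (f z) := by
  convert! Complex.hasSum_taylorSeries_on_ball hf hz using 2 with n
  simp only [taylorCoeff, sub_zero, smul_eq_mul]
  ring

lemma contDiffAt_zero_of_differentiableOn_ball {f : ℂ → ℂ} {ρ : ℝ} (hρ : 0 < ρ)
    (hf : DifferentiableOn ℂ f (ball (0 : ℂ) ρ)) (n : ℕ) : ContDiffAt ℂ n f 0 :=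
  (hf.analyticAt (ball_mem_nhds 0 hρ)).contDiffAt

lemma differentiable_taylorProj (N : ℕ) (f : ℂ → ℂ) : Differentiable ℂ (taylorProj N f) := by
  unfold taylorProj
  fun_prop

lemma taylorCoeff_sub {f g : ℂ → ℂ} {ρ : ℝ} (hρ : 0 < ρ)
    (hf : DifferentiableOn ℂ f (ball (0 : ℂ) ρ)) (hg : DifferentiableOn ℂ g (ball (0 : ℂ) ρ))
    (n : ℕ) : taylorCoeff (fun z => f z - g z) n = taylorCoeff f n - taylorCoeff g n := by
  rw [taylorCoeff, taylorCoeff, taylorCoeff, ← sub_div, iteratedDeriv_fun_sub (contDiffAt_zero_of_differentiableOn_ball hρ hf n)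
    (contDiffAt_zero_of_differentiableOn_ball hρ hg n)]

lemma taylorCoeff_taylorProj (N : ℕ) (f : ℂ → ℂ) (n : ℕ) :
    taylorCoeff (taylorProj N f) n = if n < N then taylorCoeff f n else 0 := by
  rw [taylorCoeff]
  unfold taylorProj
  rw [iteratedDeriv_fun_sum fun i _ => by fun_prop]
  simp only [iteratedDeriv_const_mul_field, iteratedDeriv_fun_pow_zero]
  have hn : (n.factorial : ℂ) ≠ 0 := by exact_mod_cast n.factorial_ne_zero
  simp only [Nat.cast_ite, Nat.cast_zero, mul_ite, mul_zero, Finset.sum_ite_eq, Finset.mem_range]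
  split_ifs <;> simp [hn]

end TaylorCoefficients

section HardyNorm

/-- Parseval's identity for `∑ n < m, a n * z ^ n` on the unit circle, as an inequality. -/
lemma sum_sq_norm_le_of_norm_sum_le (a : ℕ → ℂ) (m : ℕ) {B : ℝ}
    (hB : ∀ z : ℂ, ‖z‖ = 1 → ‖∑ n ∈ Finset.range m, a n * z ^ n‖ ≤ B) :
    ∑ n ∈ Finset.range m, ‖a n‖ ^ 2 ≤ B ^ 2 := by
  set p : Polynomial ℂ := ∑ n ∈ Finset.range m, Polynomial.C (a n) * Polynomial.X ^ n with hp
  have hcoeff : ∀ n, p.coeff n = if n < m then a n else 0 := fun n => by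
    simp [hp, Polynomial.finsetSum_coeff, Polynomial.coeff_X_pow]
  have hsum : ∑ n ∈ Finset.range m, ‖a n‖ ^ 2 = ∑ n ∈ p.support, ‖p.coeff n‖ ^ 2 := by
    rw [Finset.sum_subset (s₁ := p.support) (s₂ := Finset.range m)]
    · exact Finset.sum_congr rfl fun n hn => by rw [hcoeff, if_pos (Finset.mem_range.1 hn)]
    · intro n hn
      by_contra h
      exact Polynomial.mem_support_iff.1 hn (by rw [hcoeff, if_neg (by simpa using h)])
    · intro n _ hn
      simp [Polynomial.notMem_support_iff.1 hn]
  rw [hsum, Polynomial.sum_sq_norm_coeff_eq_circleAverage]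
  refine Real.circleAverage_mono_on_of_le_circle ?_ fun z hz => ?_
  · exact ContinuousOn.circleIntegrable' (by fun_prop)
  · have := hB z (by simpa using hz)
    have he : p.eval z = ∑ n ∈ Finset.range m, a n * z ^ n := by
      simp [hp, Polynomial.eval_finsetSum]
    rw [he]
    gcongr

lemma sum_sq_taylorCoeff_le_of_lt {g : ℂ → ℂ} {R s M : ℝ} (hs : 0 < s) (hsR : s < R)
    (hg : DifferentiableOn ℂ g (ball (0 : ℂ) R)) (hM : ∀ z ∈ ball (0 : ℂ) R, ‖g z‖ ≤ M)
    (N : ℕ) : ∑ n ∈ Finset.range N, ‖taylorCoeff g n‖ ^ 2 * s ^ (2 * n) ≤ M ^ 2 := by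
  set a : ℕ → ℂ := fun n => taylorCoeff g n * (s : ℂ) ^ n with ha
  have hsmem : (s : ℂ) ∈ ball (0 : ℂ) R := by simpa [abs_of_pos hs] using hsR
  have hnorm : Summable fun n => ‖a n‖ := (hasSum_taylorCoeff hg hsmem).summable.norm
  have htail : Tendsto (fun m => (M + ∑' n, ‖a (n + m)‖) ^ 2) atTop (𝓝 (M ^ 2)) := by
    have h := tendsto_sum_nat_add fun n => ‖a n‖
    simpa using (h.const_add M).pow 2
  have hterm : ∀ n, ‖taylorCoeff g n‖ ^ 2 * s ^ (2 * n) = ‖a n‖ ^ 2 := fun n => by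
    simp [ha, abs_of_pos hs, mul_pow, pow_mul']
  simp only [hterm]
  refine ge_of_tendsto htail (eventually_atTop.2 ⟨N, fun m hm => ?_⟩)
  calc ∑ n ∈ Finset.range N, ‖a n‖ ^ 2 ≤ ∑ n ∈ Finset.range m, ‖a n‖ ^ 2 :=
        Finset.sum_le_sum_of_subset_of_nonneg (Finset.range_mono hm) fun _ _ _ => by positivity
    _ ≤ (M + ∑' n, ‖a (n + m)‖) ^ 2 := sum_sq_norm_le_of_norm_sum_le a m fun z hz => ?_
  have hmem : (s : ℂ) * z ∈ ball (0 : ℂ) R := by simpa [abs_of_pos hs, hz] using hsR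
  have hsum : HasSum (fun n => a n * z ^ n) (g (s * z)) := by
    simpa [ha, mul_pow, mul_assoc] using hasSum_taylorCoeff hg hmem
  have hsplit := hsum.summable.sum_add_tsum_nat_add m
  rw [hsum.tsum_eq] at hsplit
  have htl : ‖∑' n, a (n + m) * z ^ (n + m)‖ ≤ ∑' n, ‖a (n + m)‖ := by
    refine tsum_of_norm_bounded ((summable_nat_add_iff m).2 hnorm).hasSum fun n => ?_
    simp [hz]
  rw [eq_sub_of_add_eq hsplit]
  exact (norm_sub_le _ _).trans (add_le_add (hM _ hmem) htl)

lemma sum_sq_taylorCoeff_le {g : ℂ → ℂ} {R M : ℝ} (hR : 0 < R)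
    (hg : DifferentiableOn ℂ g (ball (0 : ℂ) R)) (hM : ∀ z ∈ ball (0 : ℂ) R, ‖g z‖ ≤ M)
    (N : ℕ) : ∑ n ∈ Finset.range N, ‖taylorCoeff g n‖ ^ 2 * R ^ (2 * n) ≤ M ^ 2 := by
  have hcont : Continuous fun s : ℝ =>
      ∑ n ∈ Finset.range N, ‖taylorCoeff g n‖ ^ 2 * s ^ (2 * n) := by fun_prop
  refine le_of_tendsto (hcont.continuousWithinAt (s := Set.Iio R) (x := R)) ?_
  filter_upwards [Ioo_mem_nhdsLT hR] with s hs
  exact sum_sq_taylorCoeff_le_of_lt hs.1 hs.2 hg hM N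

/-- Holomorphic functions on `D_R` bounded by `M` lie in `H²(D_R)`, with norm at most `M`. -/
lemma summable_sq_taylorCoeff_of_bounded {g : ℂ → ℂ} {R M : ℝ} (hR : 0 < R)
    (hg : DifferentiableOn ℂ g (ball (0 : ℂ) R)) (hM : ∀ z ∈ ball (0 : ℂ) R, ‖g z‖ ≤ M) :
    Summable fun n => ‖taylorCoeff g n‖ ^ 2 * R ^ (2 * n) :=
  summable_of_sum_range_le (fun _ => by positivity) (sum_sq_taylorCoeff_le hR hg hM)

lemma H2normSq_le_of_bounded {g : ℂ → ℂ} {R M : ℝ} (hR : 0 < R)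
    (hg : DifferentiableOn ℂ g (ball (0 : ℂ) R)) (hM : ∀ z ∈ ball (0 : ℂ) R, ‖g z‖ ≤ M) :
    H2normSq R g ≤ M ^ 2 :=
  Real.tsum_le_of_sum_range_le (fun _ => by positivity) (sum_sq_taylorCoeff_le hR hg hM)

/-- If the low-order coefficients of `h` are dominated by those of `u` and the high-order ones
by those of `g`, then uniform bounds on `u` and `g` control the Hardy norm of `h`. -/
lemma H2norm_le_of_taylorCoeff_le {h u g : ℂ → ℂ} {ρ R A B : ℝ} (N : ℕ) (hρ : 0 < ρ)
    (hρR : ρ ≤ R) (hA : 0 ≤ A) (hB : 0 ≤ B)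
    (hu : DifferentiableOn ℂ u (ball (0 : ℂ) R)) (huA : ∀ z ∈ ball (0 : ℂ) R, ‖u z‖ ≤ A)
    (hg : DifferentiableOn ℂ g (ball (0 : ℂ) R)) (hgB : ∀ z ∈ ball (0 : ℂ) R, ‖g z‖ ≤ B)
    (hlow : ∀ n < N, ‖taylorCoeff h n‖ ≤ ‖taylorCoeff u n‖)
    (hhigh : ∀ n, N ≤ n → ‖taylorCoeff h n‖ ≤ ‖taylorCoeff g n‖) :
    H2norm ρ h ≤ A + B * (ρ / R) ^ N := by
  have hR : 0 < R := hρ.trans_le hρR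
  have hq : ρ / R ≤ 1 := (div_le_one hR).2 hρR
  have hsu := summable_sq_taylorCoeff_of_bounded hR hu huA
  have hsg := (summable_sq_taylorCoeff_of_bounded hR hg hgB).mul_left ((ρ / R) ^ (2 * N))
  have hbound : ∀ n, ‖taylorCoeff h n‖ ^ 2 * ρ ^ (2 * n) ≤
      ‖taylorCoeff u n‖ ^ 2 * R ^ (2 * n) +
        (ρ / R) ^ (2 * N) * (‖taylorCoeff g n‖ ^ 2 * R ^ (2 * n)) := fun n => by
    rcases lt_or_ge n N with hn | hn
    · refine le_add_of_le_of_nonneg ?_ (by positivity)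
      have := hlow n hn
      gcongr
    · refine le_add_of_nonneg_of_le (by positivity) ?_
      have h1 : ρ ^ (2 * n) = (ρ / R) ^ (2 * n) * R ^ (2 * n) := by
        rw [← mul_pow, div_mul_cancel₀ _ hR.ne']
      have h2 : (ρ / R) ^ (2 * n) ≤ (ρ / R) ^ (2 * N) :=
        pow_le_pow_of_le_one (by positivity) hq (by omega)
      have := hhigh n hn
      calc ‖taylorCoeff h n‖ ^ 2 * ρ ^ (2 * n)
          ≤ ‖taylorCoeff g n‖ ^ 2 * ((ρ / R) ^ (2 * N) * R ^ (2 * n)) := by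
            rw [h1]; gcongr
        _ = _ := by ring
  have hsh : Summable fun n => ‖taylorCoeff h n‖ ^ 2 * ρ ^ (2 * n) :=
    Summable.of_nonneg_of_le (fun _ => by positivity) hbound (hsu.add hsg)
  have hsq : H2normSq ρ h ≤ A ^ 2 + (ρ / R) ^ (2 * N) * B ^ 2 := by
    calc H2normSq ρ h ≤ H2normSq R u + (ρ / R) ^ (2 * N) * H2normSq R g := by
          unfold H2normSq
          rw [← tsum_mul_left, ← hsu.tsum_add hsg]
          exact hsh.tsum_le_tsum hbound (hsu.add hsg)
      _ ≤ _ := by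
          gcongr
          · exact H2normSq_le_of_bounded hR hu huA
          · exact H2normSq_le_of_bounded hR hg hgB
  refine Real.sqrt_le_iff.2 ⟨by positivity, hsq.trans ?_⟩
  have : 0 ≤ A * (B * (ρ / R) ^ N) := by positivity
  rw [pow_mul']
  nlinarith

/-- Pointwise bound for the Taylor remainder of a function in `H²(D_ρ)` on a smaller disk. -/
lemma norm_sub_taylorProj_le {f : ℂ → ℂ} {r ρ : ℝ} (hr : 0 < r) (hrρ : r < ρ)
    (hf : DifferentiableOn ℂ f (ball (0 : ℂ) ρ))
    (hfH2 : Summable fun n => ‖taylorCoeff f n‖ ^ 2 * ρ ^ (2 * n)) (N : ℕ)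
    {z : ℂ} (hz : z ∈ ball (0 : ℂ) r) :
    ‖f z - taylorProj N f z‖ ≤ ρ / √(ρ ^ 2 - r ^ 2) * (r / ρ) ^ N * H2norm ρ f := by
  have hρ : 0 < ρ := hr.trans hrρ
  have hq : (r / ρ) ^ 2 < 1 := pow_lt_one₀ (by positivity) ((div_lt_one hρ).2 hrρ) two_ne_zero
  have hd : 0 < ρ ^ 2 - r ^ 2 := by nlinarith
  have hsum : HasSum (fun n => taylorCoeff f (n + N) * z ^ (n + N)) (f z - taylorProj N f z) :=
    (hasSum_nat_add_iff' N).2 (hasSum_taylorCoeff hf (ball_subset_ball hrρ.le hz))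
  refine le_of_tendsto hsum.tendsto_sum_nat.norm (Eventually.of_forall fun m => ?_)
  have hz' : ‖z‖ ≤ r := by simpa using (mem_ball_zero_iff.1 hz).le
  have hterm : ∀ n, ‖taylorCoeff f (n + N) * z ^ (n + N)‖ ≤
      (‖taylorCoeff f (n + N)‖ * ρ ^ (n + N)) * (r / ρ) ^ (n + N) := fun n => by
    rw [norm_mul, norm_pow, mul_assoc, ← mul_pow, mul_div_cancel₀ _ hρ.ne']
    gcongr
  refine (norm_sum_le_of_le _ fun n _ => hterm n).trans (abs_le_of_sq_le_sq' ?_ ?_).2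
  · refine (Finset.sum_mul_sq_le_sq_mul_sq _ _ _).trans ?_
    have h1 : ∑ n ∈ Finset.range m, (‖taylorCoeff f (n + N)‖ * ρ ^ (n + N)) ^ 2 ≤
        H2norm ρ f ^ 2 := by
      have hnn : ∀ n, 0 ≤ ‖taylorCoeff f n‖ ^ 2 * ρ ^ (2 * n) := fun n => by positivity
      rw [H2norm, H2normSq, Real.sq_sqrt (tsum_nonneg hnn), ← hfH2.sum_add_tsum_nat_add N]
      refine le_add_of_nonneg_of_le (Finset.sum_nonneg fun n _ => hnn n) ?_
      simpa only [mul_pow, ← pow_mul, mul_comm _ 2] using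
        ((summable_nat_add_iff N).2 hfH2).sum_le_tsum (Finset.range m) fun n _ => hnn _
    have h2 : ∑ n ∈ Finset.range m, ((r / ρ) ^ (n + N)) ^ 2 ≤
        ((r / ρ) ^ N) ^ 2 * (ρ ^ 2 / (ρ ^ 2 - r ^ 2)) := by
      have hgeom := hasSum_geometric_of_lt_one (by positivity) hq
      have hle := hgeom.summable.sum_le_tsum (Finset.range m) fun n _ => by positivity
      rw [hgeom.tsum_eq] at hle
      have heq : (1 - (r / ρ) ^ 2)⁻¹ = ρ ^ 2 / (ρ ^ 2 - r ^ 2) := by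
        field_simp
      rw [← heq]
      refine le_trans (le_of_eq ?_) (mul_le_mul_of_nonneg_left hle (by positivity))
      rw [Finset.mul_sum]
      exact Finset.sum_congr rfl fun n _ => by ring
    refine (mul_le_mul h1 h2 (Finset.sum_nonneg fun _ _ => by positivity) (by positivity)).trans
      (le_of_eq ?_)
    rw [mul_pow, mul_pow, div_pow ρ, Real.sq_sqrt hd.le]
    ring
  · have : 0 ≤ H2norm ρ f := Real.sqrt_nonneg _
    positivity

end HardyNorm

section TransferOperator

variable {d : ℕ} {σ : Fin d → ℂ} {φ : Fin d → ℂ → ℂ} {r R : ℝ}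

lemma differentiableOn_transferOp {f : ℂ → ℂ}
    (hφ : ∀ ℓ, DifferentiableOn ℂ (φ ℓ) (ball (0 : ℂ) R))
    (hmap : ∀ ℓ, Set.MapsTo (φ ℓ) (ball (0 : ℂ) R) (ball (0 : ℂ) r))
    (hf : DifferentiableOn ℂ f (ball (0 : ℂ) r)) :
    DifferentiableOn ℂ (transferOp σ φ f) (ball (0 : ℂ) R) := by
  unfold transferOp
  refine DifferentiableOn.fun_sum fun ℓ _ => ?_
  exact (((hφ ℓ).deriv isOpen_ball).const_mul (σ ℓ)).mul (hf.comp (hφ ℓ) (hmap ℓ))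

lemma transferOp_sub (f g : ℂ → ℂ) (z : ℂ) :
    transferOp σ φ f z - transferOp σ φ g z = transferOp σ φ (fun w => f w - g w) z := by
  simp only [transferOp, mul_sub, Finset.sum_sub_distrib]

lemma norm_transferOp_le {f : ℂ → ℂ} {K B : ℝ} (hB : 0 ≤ B) (hσ : ∀ ℓ, ‖σ ℓ‖ ≤ 1)
    (hmap : ∀ ℓ, Set.MapsTo (φ ℓ) (ball (0 : ℂ) R) (ball (0 : ℂ) r))
    (hK : ∀ z ∈ ball (0 : ℂ) R, ∑ ℓ, ‖deriv (φ ℓ) z‖ ≤ K)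
    (hfB : ∀ z ∈ ball (0 : ℂ) r, ‖f z‖ ≤ B) {z : ℂ} (hz : z ∈ ball (0 : ℂ) R) :
    ‖transferOp σ φ f z‖ ≤ K * B := by
  refine (norm_sum_le_of_le Finset.univ fun ℓ _ => ?_).trans
    ((Finset.sum_mul _ _ _).symm.trans_le (mul_le_mul_of_nonneg_right (hK z hz) hB))
  rw [norm_mul, norm_mul]
  exact mul_le_mul (mul_le_of_le_one_left (norm_nonneg _) (hσ ℓ)) (hfB _ (hmap ℓ hz))
    (norm_nonneg _) (norm_nonneg _)

end TransferOperator

/-- Finite-rank Taylor approximation of the transfer operator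
(Proposition 4 of the paper). -/
theorem transfer_operator_taylor_approximation
    (d : ℕ) (r R ρ : ℝ) (hr : 1 < r) (hrρ : r < ρ) (hρR : ρ < R)
    (φ : Fin d → ℂ → ℂ) (σ : Fin d → ℂ)
    (hφ : ∀ ℓ, DifferentiableOn ℂ (φ ℓ) (ball (0 : ℂ) R))
    (hmap : ∀ ℓ, Set.MapsTo (φ ℓ) (ball (0 : ℂ) R) (ball (0 : ℂ) r))
    (hσ : ∀ ℓ, σ ℓ = 1 ∨ σ ℓ = -1)
    (K : ℝ) (hK : ∀ z ∈ ball (0 : ℂ) R, ∑ ℓ, ‖deriv (φ ℓ) z‖ ≤ K)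
    (C : ℝ) (hC : C = ρ / Real.sqrt (ρ ^ 2 - r ^ 2) * K)
    (f : ℂ → ℂ)
    (hf : DifferentiableOn ℂ f (ball (0 : ℂ) ρ))
    (hfH2 : Summable (fun n => ‖taylorCoeff f n‖ ^ 2 * ρ ^ (2 * n))) :
    ∀ N : ℕ,
      (DifferentiableOn ℂ (transferOp σ φ f) (ball (0 : ℂ) R) ∧
        H2norm ρ (fun z => transferOp σ φ f z - taylorProj N (transferOp σ φ f) z) ≤
          C * (ρ / R) ^ N * H2norm ρ f) ∧
      (H2norm ρ (fun z => transferOp σ φ f z - transferOp σ φ (taylorProj N f) z) ≤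
          C * (r / ρ) ^ N * H2norm ρ f) ∧
      (H2norm ρ
          (fun z => transferOp σ φ f z -
            taylorProj N (transferOp σ φ (taylorProj N f)) z) ≤
          C * ((ρ / R) ^ N + (r / ρ) ^ N) * H2norm ρ f) ∧
      (ρ = Real.sqrt (R * r) →
        H2norm ρ
            (fun z => transferOp σ φ f z -
              taylorProj N (transferOp σ φ (taylorProj N f)) z) ≤
          2 * C * Real.sqrt (r / R) ^ N * H2norm ρ f) := by
  have hr0 : 0 < r := one_pos.trans hr
  have hρ0 : 0 < ρ := hr0.trans hrρ
  have hR0 : 0 < R := hρ0.trans hρR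
  have hK0 : 0 ≤ K :=
    (Finset.sum_nonneg fun _ _ => norm_nonneg _).trans (hK 0 (mem_ball_self hR0))
  have hC0 : 0 ≤ C := hC ▸ by positivity
  have hf0 : 0 ≤ H2norm ρ f := Real.sqrt_nonneg _
  have hσ1 : ∀ ℓ, ‖σ ℓ‖ ≤ 1 := fun ℓ => by rcases hσ ℓ with h | h <;> simp [h]
  have hfr := hf.mono (ball_subset_ball hrρ.le)
  set g := transferOp σ φ f with hg_def
  have hg : DifferentiableOn ℂ g (ball 0 R) := differentiableOn_transferOp hφ hmap hfr
  have hgρ := hg.mono (ball_subset_ball hρR.le)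
  have hgN : ∀ N, DifferentiableOn ℂ (transferOp σ φ (taylorProj N f)) (ball 0 R) := fun N =>
    differentiableOn_transferOp hφ hmap (differentiable_taylorProj N f).differentiableOn
  have hdiff : ∀ N, ∀ z ∈ ball (0 : ℂ) R,
      ‖g z - transferOp σ φ (taylorProj N f) z‖ ≤ C * (r / ρ) ^ N * H2norm ρ f := by
    intro N z hz
    rw [hg_def, transferOp_sub]
    refine (norm_transferOp_le (by positivity) hσ1 hmap hK
      (fun w hw => norm_sub_taylorProj_le hr0 hrρ hf hfH2 N hw) hz).trans (le_of_eq ?_)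
    rw [hC]
    ring
  have hgC : ∀ z ∈ ball (0 : ℂ) R, ‖g z‖ ≤ C * H2norm ρ f := fun z hz => by
    simpa [transferOp, taylorProj] using hdiff 0 z hz
  intro N
  have hPdiff : ∀ h : ℂ → ℂ, DifferentiableOn ℂ (taylorProj N h) (ball 0 ρ) := fun h =>
    (differentiable_taylorProj N h).differentiableOn
  have htotal : H2norm ρ (fun z => g z - taylorProj N (transferOp σ φ (taylorProj N f)) z) ≤
      C * ((ρ / R) ^ N + (r / ρ) ^ N) * H2norm ρ f := by
    refine (H2norm_le_of_taylorCoeff_le N hρ0 hρR.le (by positivity) (by positivity)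
      (hg.fun_sub (hgN N)) (hdiff N) hg hgC (fun n hn => ?_) fun n hn => ?_).trans (le_of_eq ?_)
    · rw [taylorCoeff_sub hρ0 hgρ (hPdiff _), taylorCoeff_taylorProj, if_pos hn]
      exact (congrArg norm (taylorCoeff_sub hR0 hg (hgN N) n)).ge
    · rw [taylorCoeff_sub hρ0 hgρ (hPdiff _), taylorCoeff_taylorProj, if_neg hn.not_gt, sub_zero]
    · ring
  refine ⟨⟨hg, ?_⟩, ?_, htotal, fun hρ => ?_⟩
  · refine (H2norm_le_of_taylorCoeff_le (u := fun _ => 0) (A := 0) N hρ0 hρR.le le_rfl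
      (by positivity) (differentiableOn_const 0) (by simp) hg hgC (fun n hn => ?_)
      fun n hn => ?_).trans (le_of_eq ?_)
    · rw [taylorCoeff_sub hρ0 hgρ (hPdiff _), taylorCoeff_taylorProj, if_pos hn, sub_self,
        norm_zero]
      exact norm_nonneg _
    · rw [taylorCoeff_sub hρ0 hgρ (hPdiff _), taylorCoeff_taylorProj, if_neg hn.not_gt, sub_zero]
    · ring
  · simpa using H2norm_le_of_taylorCoeff_le (A := 0) 0 hρ0 hρR.le le_rfl (by positivity)
      (differentiableOn_const 0) (by simp) (hg.fun_sub (hgN N)) (hdiff N)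
      (by simp) fun n _ => le_rfl
  · have hρsq : ρ ^ 2 = R * r := by rw [hρ, Real.sq_sqrt (by positivity)]
    have h1 : √(r / R) = ρ / R := by
      rw [Real.sqrt_eq_iff_eq_sq (by positivity) (by positivity), div_pow, hρsq]
      field_simp
    have h2 : r / ρ = ρ / R := by
      rw [div_eq_div_iff hρ0.ne' hR0.ne']
      linarith
    rw [h1]
    refine htotal.trans (le_of_eq ?_)
    rw [h2]
    ring
end

section
/- Let T be an analytic full branch map on [−1,1] with d branches and let S be the set of its d−1 critical points (the common interior endpoints of the branch intervals). Let ‖T'‖ = sup_{x∈[−1,1]∖S} |T'(x)|. Let M ∈ ℕ, 0 ≤ δ ≤ 2/M, and x_m = −1 + δ + 2m/M for m = 0,…,M−1, and assume no node x_m lies in S. Then for all k, ℓ ∈ ℕ₀, |(1/2)∫_{−1}^1 T(x)^k x^ℓ dx − (1/M)∑_{m=0}^{M−1} T(x_m)^k x_m^ℓ| ≤ max(‖T'‖, 2(d−1)) · (k+ℓ+1)/M. -/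
/-- The integral of the distance to a point of the interval. -/
lemma integral_abs_sub_of_mem {α β y : ℝ} (h1 : α ≤ y) (h2 : y ≤ β) :
    ∫ x in α..β, |x - y| = ((y - α) ^ 2 + (β - y) ^ 2) / 2 := by
  have hi : ∀ a b : ℝ, IntervalIntegrable (fun x : ℝ => |x - y|) MeasureTheory.volume a b :=
    fun a b => (by fun_prop : Continuous fun x : ℝ => |x - y|).intervalIntegrable a b
  rw [← intervalIntegral.integral_add_adjacent_intervals (hi α y) (hi y β)]
  have e1 : ∫ x in α..y, |x - y| = ∫ x in α..y, (y - x) := by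
    refine intervalIntegral.integral_congr fun x hx => ?_
    rw [Set.uIcc_of_le h1] at hx
    rw [abs_of_nonpos (by linarith [hx.2])]
    ring
  have e2 : ∫ x in y..β, |x - y| = ∫ x in y..β, (x - y) := by
    refine intervalIntegral.integral_congr fun x hx => ?_
    rw [Set.uIcc_of_le h2] at hx
    rw [abs_of_nonneg (by linarith [hx.1])]
  rw [e1, e2, intervalIntegral.integral_sub (by simp) (by simp),
    intervalIntegral.integral_sub (by simp) (by simp)]
  simp only [intervalIntegral.integral_const, integral_id, smul_eq_mul]
  ring

/-- `g` is Lipschitz with constant `L` on `[-1, 1] \ F`, up to jumps of size at most `J`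
at the points of `S`. -/
def LipschitzWithJumps (g : ℝ → ℝ) (F S : Finset ℝ) (L J : ℝ) : Prop :=
  ∀ x ∈ Set.Icc (-1 : ℝ) 1, ∀ y ∈ Set.Icc (-1 : ℝ) 1, x ∉ F → y ∉ F → x < y →
    |g x - g y| ≤ L * (y - x) + J * ((S.filter (· ∈ Set.Ioo x y)).card : ℝ)

/-- One-node quadrature error on a single cell. -/
lemma LipschitzWithJumps.cell_error {g : ℝ → ℝ} {F S : Finset ℝ} {L J : ℝ}
    (H : LipschitzWithJumps g F S L J) (hJ : 0 ≤ J)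
    {α β y : ℝ} (hα : -1 ≤ α) (hβ : β ≤ 1) (h1 : α ≤ y) (h2 : y ≤ β) (hy : y ∉ F)
    (hg : IntervalIntegrable g MeasureTheory.volume α β) :
    |(∫ x in α..β, g x) - (β - α) * g y| ≤
      L * (((y - α) ^ 2 + (β - y) ^ 2) / 2) +
        J * (β - α) * ((S.filter (· ∈ Set.Ioo α β)).card : ℝ) := by
  set N : ℝ := ((S.filter (· ∈ Set.Ioo α β)).card : ℝ) with hN
  have e : (∫ x in α..β, g x) - (β - α) * g y = ∫ x in α..β, (g x - g y) := by
    rw [intervalIntegral.integral_sub hg (by simp)]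
    simp
  have hc : IntervalIntegrable (fun x : ℝ => L * |x - y|) MeasureTheory.volume α β :=
    (by fun_prop : Continuous fun x : ℝ => L * |x - y|).intervalIntegrable _ _
  have e2 : L * (((y - α) ^ 2 + (β - y) ^ 2) / 2) + J * (β - α) * N =
      ∫ x in α..β, (L * |x - y| + J * N) := by
    rw [intervalIntegral.integral_add hc (by simp), intervalIntegral.integral_const_mul,
      integral_abs_sub_of_mem h1 h2]
    simp only [intervalIntegral.integral_const, smul_eq_mul]
    ring
  rw [e, e2, ← Real.norm_eq_abs]
  refine intervalIntegral.norm_integral_le_of_norm_le (h1.trans h2) ?_ (hc.add (by simp))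
  have hF : ∀ᵐ x : ℝ, x ∉ F := by
    have := F.finite_toSet.countable.ae_notMem MeasureTheory.volume
    simpa using this
  filter_upwards [hF] with x hxF hx
  rw [Real.norm_eq_abs]
  rcases lt_trichotomy x y with h | h | h
  · have hb := H x ⟨by linarith [hx.1], by linarith [hx.2]⟩ y ⟨by linarith, by linarith⟩ hxF hy h
    have hsub : ((S.filter (· ∈ Set.Ioo x y)).card : ℝ) ≤ N := by
      rw [hN]
      exact_mod_cast Finset.card_le_card (Finset.monotone_filter_right S
        fun z _ hz => Set.Ioo_subset_Ioo hx.1.le h2 hz)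
    rw [abs_of_neg (sub_neg.2 h)]
    have := mul_le_mul_of_nonneg_left hsub hJ
    linarith
  · subst h
    simp only [sub_self, abs_zero, mul_zero, zero_add]
    exact mul_nonneg hJ (Nat.cast_nonneg _)
  · have hb := H y ⟨by linarith, by linarith⟩ x ⟨by linarith [hx.1], by linarith [hx.2]⟩ hy hxF h
    have hsub : ((S.filter (· ∈ Set.Ioo y x)).card : ℝ) ≤ N := by
      rw [hN]
      exact_mod_cast Finset.card_le_card (Finset.monotone_filter_right S
        fun z _ hz => Set.Ioo_subset_Ioo h1 hx.2 hz)
    rw [abs_of_pos (sub_pos.2 h), abs_sub_comm]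
    have := mul_le_mul_of_nonneg_left hsub hJ
    linarith

/-- Consecutive open cells share no point of a finite set. -/
lemma sum_card_filter_Ioo_le (S : Finset ℝ) (a : ℕ → ℝ) (ha : Monotone a) (n : ℕ) :
    ∑ m ∈ Finset.range n, (S.filter (· ∈ Set.Ioo (a m) (a (m + 1)))).card ≤
      (S.filter (· < a n)).card := by
  induction n with
  | zero => simp
  | succ n ih =>
    rw [Finset.sum_range_succ]
    refine (Nat.add_le_add_right ih _).trans ?_
    rw [← Finset.card_union_of_disjoint]
    · refine Finset.card_le_card fun z hz => ?_
      have := ha n.le_succ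
      simp only [Finset.mem_union, Finset.mem_filter, Set.mem_Ioo] at hz ⊢
      rcases hz with hz | hz
      · exact ⟨hz.1, hz.2.trans_le this⟩
      · exact ⟨hz.1, hz.2.2⟩
    · rw [Finset.disjoint_left]
      intro z hz hz'
      simp only [Finset.mem_filter, Set.mem_Ioo] at hz hz'
      exact lt_asymm hz.2 hz'.2.1

/-- Quadrature error over `n` consecutive cells of equal length. -/
lemma LipschitzWithJumps.cells_error {g : ℝ → ℝ} {F S : Finset ℝ} {L J : ℝ}
    (H : LipschitzWithJumps g F S L J) (hL : 0 ≤ L) (hJ : 0 ≤ J)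
    (hg : IntervalIntegrable g MeasureTheory.volume (-1) 1)
    {α h Q : ℝ} {n : ℕ} (hh : 0 ≤ h) (hα : -1 ≤ α) (hn : α + n * h ≤ 1) (y : ℕ → ℝ)
    (h1 : ∀ m < n, α + m * h ≤ y m) (h2 : ∀ m < n, y m ≤ α + m * h + h)
    (hQ : ∀ m < n, (y m - (α + m * h)) ^ 2 + (α + m * h + h - y m) ^ 2 ≤ Q)
    (hy : ∀ m < n, y m ∉ F) :
    |(∫ x in α..(α + n * h), g x) - h * ∑ m ∈ Finset.range n, g (y m)| ≤
      n * (L * (Q / 2)) + J * h * S.card := by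
  set a : ℕ → ℝ := fun m => α + m * h with ha
  have hmono : Monotone a := by
    intro i j hij
    have : (i : ℝ) ≤ j := by exact_mod_cast hij
    simp only [ha]
    nlinarith
  have hs : ∀ m, a (m + 1) = a m + h := by
    intro m; simp only [ha]; push_cast; ring
  have ha0 : ∀ m, -1 ≤ a m := fun m => by
    have := hmono (Nat.zero_le m)
    simp only [ha, Nat.cast_zero, zero_mul, add_zero] at this ⊢
    linarith
  have ha1 : ∀ m ≤ n, a m ≤ 1 := fun m hm => (hmono hm).trans hn
  have hgi : ∀ m < n, IntervalIntegrable g MeasureTheory.volume (a m) (a (m + 1)) := by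
    intro m hm
    refine hg.mono_set ?_
    rw [Set.uIcc_of_le (hmono m.le_succ), Set.uIcc_of_le (by norm_num)]
    exact Set.Icc_subset_Icc (ha0 m) (ha1 _ hm)
  have e0 : α = a 0 := by simp [ha]
  have e := intervalIntegral.sum_integral_adjacent_intervals hgi
  rw [← e0] at e
  rw [show α + n * h = a n from rfl, ← e, Finset.mul_sum, ← Finset.sum_sub_distrib]
  refine (Finset.abs_sum_le_sum_abs _ _).trans ?_
  have hterm : ∀ m ∈ Finset.range n,
      |(∫ x in a m..a (m + 1), g x) - h * g (y m)| ≤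
        L * (Q / 2) + J * h * ((S.filter (· ∈ Set.Ioo (a m) (a (m + 1)))).card : ℝ) := by
    intro m hm
    rw [Finset.mem_range] at hm
    have hc := H.cell_error hJ (ha0 m) (ha1 (m + 1) hm) (h1 m hm)
      (by rw [hs]; exact h2 m hm) (hy m hm) (hgi m hm)
    rw [show a (m + 1) - a m = h by rw [hs]; ring] at hc
    have hq : (y m - a m) ^ 2 + (a (m + 1) - y m) ^ 2 ≤ Q := by rw [hs]; exact hQ m hm
    have : L * (((y m - a m) ^ 2 + (a (m + 1) - y m) ^ 2) / 2) ≤ L * (Q / 2) := by gcongr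
    linarith
  refine (Finset.sum_le_sum hterm).trans ?_
  rw [Finset.sum_add_distrib, Finset.sum_const, ← Finset.mul_sum, Finset.card_range, nsmul_eq_mul]
  have hcard : (∑ m ∈ Finset.range n,
      ((S.filter (· ∈ Set.Ioo (a m) (a (m + 1)))).card : ℝ)) ≤ S.card := by
    exact_mod_cast (sum_card_filter_Ioo_le S a hmono n).trans (Finset.card_filter_le _ _)
  gcongr

/-- Quadrature error when every equidistant node avoids the exceptional set. -/
lemma LipschitzWithJumps.rectangle_error {g : ℝ → ℝ} {F S : Finset ℝ} {L J : ℝ}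
    (H : LipschitzWithJumps g F S L J) (hL : 0 ≤ L) (hJ : 0 ≤ J)
    (hg : IntervalIntegrable g MeasureTheory.volume (-1) 1)
    {M : ℕ} (hM : 0 < M) {δ : ℝ} (hδ0 : 0 ≤ δ) (hδ : δ ≤ 2 / M)
    (hy : ∀ m < M, (-1 + δ + 2 * (m : ℝ) / M) ∉ F) :
    |1 / 2 * (∫ x in (-1 : ℝ)..1, g x) -
        1 / M * ∑ m ∈ Finset.range M, g (-1 + δ + 2 * m / M)| ≤ (L + J * S.card) / M := by
  have hM' : (0 : ℝ) < M := by exact_mod_cast hM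
  have hend : (-1 : ℝ) + M * (2 / M) = 1 := by field_simp; norm_num
  have key := H.cells_error hL hJ hg (α := -1) (h := 2 / M) (Q := (2 / M) ^ 2) (n := M)
    (by positivity) le_rfl hend.le (fun m => -1 + δ + 2 * (m : ℝ) / M)
    (fun m _ => by ring_nf; linarith) (fun m _ => by ring_nf at hδ ⊢; linarith)
    (fun m _ => by
      have e1 : -1 + δ + 2 * (m : ℝ) / M - (-1 + m * (2 / M)) = δ := by ring
      have e2 : -1 + (m : ℝ) * (2 / M) + 2 / M - (-1 + δ + 2 * m / M) = 2 / M - δ := by ring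
      rw [e1, e2]
      nlinarith) hy
  rw [hend] at key
  have e : 1 / 2 * (∫ x in (-1 : ℝ)..1, g x) -
        1 / M * ∑ m ∈ Finset.range M, g (-1 + δ + 2 * m / M) =
      1 / 2 * ((∫ x in (-1 : ℝ)..1, g x) -
        2 / M * ∑ m ∈ Finset.range M, g (-1 + δ + 2 * m / M)) := by ring
  rw [e, abs_mul, abs_of_pos (by norm_num : (0 : ℝ) < 1 / 2)]
  calc _ ≤ 1 / 2 * (M * (L * ((2 / M) ^ 2 / 2)) + J * (2 / M) * S.card) := by gcongr
    _ = _ := by field_simp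

/-- Quadrature error for the interior equidistant nodes, with an arbitrary value `v` in place of
the value of `g` at the endpoints. -/
lemma LipschitzWithJumps.midpoint_error {g : ℝ → ℝ} {F S : Finset ℝ} {L J : ℝ}
    (H : LipschitzWithJumps g F S L J) (hL : 0 ≤ L) (hJ : 0 ≤ J)
    (hg : IntervalIntegrable g MeasureTheory.volume (-1) 1) (n : ℕ)
    (hy : ∀ m < n, (-1 + 2 * ((m : ℝ) + 1) / (n + 1)) ∉ F) {v B : ℝ}
    (hv : |(∫ x in (-1 : ℝ)..(-1 + 1 / (n + 1)), g x) + (∫ x in (1 - 1 / (n + 1 : ℝ))..1, g x)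
      - 2 / (n + 1) * v| ≤ 2 / (n + 1) * B) :
    |1 / 2 * (∫ x in (-1 : ℝ)..1, g x) -
        1 / (n + 1) * (∑ m ∈ Finset.range n, g (-1 + 2 * (m + 1) / (n + 1)) + v)| ≤
      (n / (n + 1) * (L / 2) + J * S.card + B) / (n + 1) := by
  have hn : (0 : ℝ) < n + 1 := by positivity
  have hle : 1 / ((n : ℝ) + 1) ≤ 1 := by
    rw [div_le_one hn]; linarith [(Nat.cast_nonneg n : (0 : ℝ) ≤ n)]
  have hpos : 0 < 1 / ((n : ℝ) + 1) := by positivity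
  set t : ℝ := 1 / (n + 1) with ht
  have htn : (n : ℝ) * t = 1 - t := by rw [ht]; field_simp; ring
  have h2t : 2 / ((n : ℝ) + 1) = 2 * t := by rw [ht]; ring
  have hend : -1 + t + n * (2 * t) = 1 - t := by linarith
  have hnode : ∀ m : ℕ, -1 + 2 * ((m : ℝ) + 1) / (n + 1) = -1 + 2 * (m + 1) * t := by
    intro m; rw [ht]; ring
  have key := H.cells_error hL hJ hg (α := -1 + t) (h := 2 * t) (Q := 2 * t ^ 2) (n := n)
    (by positivity) (by linarith) (by linarith) (fun m => -1 + 2 * ((m : ℝ) + 1) / (n + 1))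
    (fun m _ => by rw [hnode]; linarith) (fun m _ => by rw [hnode]; linarith)
    (fun m _ => by rw [hnode]; apply le_of_eq; ring) hy
  rw [hend] at key
  have hsub : ∀ p q : ℝ, -1 ≤ p → p ≤ q → q ≤ 1 →
      IntervalIntegrable g MeasureTheory.volume p q := by
    intro p q h1 h2 h3
    refine hg.mono_set ?_
    rw [Set.uIcc_of_le h2, Set.uIcc_of_le (by norm_num)]
    exact Set.Icc_subset_Icc h1 h3
  have hnt : 0 ≤ (n : ℝ) * t := by positivity
  have s1 := intervalIntegral.integral_add_adjacent_intervals
    (hsub (-1) (-1 + t) le_rfl (by linarith) (by linarith))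
    (hsub (-1 + t) (1 - t) (by linarith) (by nlinarith) (by linarith))
  have s2 := intervalIntegral.integral_add_adjacent_intervals
    (hsub (-1) (1 - t) le_rfl (by linarith) (by linarith))
    (hsub (1 - t) 1 (by linarith) (by linarith) le_rfl)
  rw [h2t] at hv
  set A := ∑ m ∈ Finset.range n, g (-1 + 2 * (m + 1) / (n + 1))
  have e : 1 / 2 * (∫ x in (-1 : ℝ)..1, g x) - t * (A + v) =
      1 / 2 * ((((∫ x in (-1 : ℝ)..(-1 + t), g x) + ∫ x in (1 - t)..1, g x) - 2 * t * v) +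
        ((∫ x in (-1 + t)..(1 - t), g x) - 2 * t * A)) := by
    rw [← s2, ← s1]; ring
  rw [e, abs_mul, abs_of_pos (by norm_num : (0 : ℝ) < 1 / 2)]
  calc _ ≤ 1 / 2 * (2 * t * B + (n * (L * (2 * t ^ 2 / 2)) + J * (2 * t) * S.card)) := by
        gcongr
        exact (abs_add_le _ _).trans (add_le_add hv key)
    _ = _ := by rw [ht]; field_simp; ring

/-- A full branch map `T` of `[-1, 1]` with breakpoints `c 0 < ⋯ < c d`, analytic on each branch,
whose derivative is bounded by `K` off the critical points. -/
structure IsFullBranchMap (d : ℕ) (c : ℕ → ℝ) (T : ℝ → ℝ) (K : ℝ) : Prop where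
  pos : 0 < d
  left : c 0 = -1
  right : c d = 1
  lt_succ : ∀ i < d, c i < c (i + 1)
  mapsTo : Set.MapsTo T (Set.Icc (-1 : ℝ) 1) (Set.Icc (-1 : ℝ) 1)
  analytic : ∀ i < d, AnalyticOnNhd ℝ T (Set.Ioo (c i) (c (i + 1)))
  bijOn : ∀ i < d, Set.BijOn T (Set.Ioo (c i) (c (i + 1))) (Set.Ioo (-1 : ℝ) 1)
  deriv_le : ∀ x ∈ Set.Icc (-1 : ℝ) 1 \ (c '' Set.Ioo 0 d), |deriv T x| ≤ K

/-- A monotone or antitone `K`-Lipschitz surjection of an interval onto `(-1, 1)` has opposite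
limits `±1` at the two ends, attained at linear rate. -/
lemma exists_end_values {T : ℝ → ℝ} {p q K : ℝ} (hpq : p < q)
    (hcont : ContinuousOn T (Set.Ioo p q))
    (hbij : Set.BijOn T (Set.Ioo p q) (Set.Ioo (-1 : ℝ) 1)) (hK : 0 ≤ K)
    (hlip : ∀ x ∈ Set.Ioo p q, ∀ y ∈ Set.Ioo p q, |T x - T y| ≤ K * |x - y|) :
    ∃ a : ℝ, (a = 1 ∨ a = -1) ∧
      ∀ x ∈ Set.Ioo p q, |T x - a| ≤ K * (x - p) ∧ |T x + a| ≤ K * (q - x) := by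
  have hup : ∀ x ∈ Set.Ioo p q, ∀ D, (∀ z ∈ Set.Ioo p q, T x < T z → |z - x| ≤ D) →
      1 - T x ≤ K * D := by
    intro x hx D hD
    refine le_of_forall_lt fun w hw => ?_
    have hx1 := hbij.mapsTo hx
    obtain ⟨u, hu1, hu2⟩ := exists_between (max_lt (by linarith) hx1.2 : max (w + T x) (T x) < 1)
    have hux : T x < u := (le_max_right _ _).trans_lt hu1
    obtain ⟨z, hz, rfl⟩ := hbij.surjOn ⟨hx1.1.trans hux, hu2⟩
    have h1 := hlip z hz x hx
    have h2 := mul_le_mul_of_nonneg_left (hD z hz hux) hK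
    have h3 := (le_max_left _ _).trans_lt hu1
    have h4 := le_abs_self (T z - T x)
    linarith
  have hdown : ∀ x ∈ Set.Ioo p q, ∀ D, (∀ z ∈ Set.Ioo p q, T z < T x → |z - x| ≤ D) →
      1 + T x ≤ K * D := by
    intro x hx D hD
    refine le_of_forall_lt fun w hw => ?_
    have hx1 := hbij.mapsTo hx
    obtain ⟨u, hu1, hu2⟩ := exists_between (lt_min (by linarith) hx1.1 : -1 < min (T x - w) (T x))
    have hux : u < T x := hu2.trans_le (min_le_right _ _)
    obtain ⟨z, hz, rfl⟩ := hbij.surjOn ⟨hu1, hux.trans hx1.2⟩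
    have h1 := hlip z hz x hx
    have h2 := mul_le_mul_of_nonneg_left (hD z hz hux) hK
    have h3 := hu2.trans_le (min_le_left _ _)
    have h4 := neg_abs_le (T z - T x)
    linarith
  rcases ContinuousOn.strictMonoOn_of_injOn_Ioo hpq hcont hbij.injOn with hm | hm
  · refine ⟨-1, Or.inr rfl, fun x hx => ?_⟩
    have hx1 := hbij.mapsTo hx
    have h1 := hup x hx (q - x) fun z hz h => by
      have := (hm.lt_iff_lt hx hz).1 h
      rw [abs_of_pos (by linarith)]; linarith [hz.2]
    have h2 := hdown x hx (x - p) fun z hz h => by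
      have := (hm.lt_iff_lt hz hx).1 h
      rw [abs_of_neg (by linarith)]; linarith [hz.1]
    exact ⟨by rw [abs_of_pos (by linarith [hx1.1])]; linarith,
      by rw [abs_of_neg (by linarith [hx1.2])]; linarith⟩
  · refine ⟨1, Or.inl rfl, fun x hx => ?_⟩
    have hx1 := hbij.mapsTo hx
    have h1 := hup x hx (x - p) fun z hz h => by
      have := (hm.lt_iff_gt hx hz).1 h
      rw [abs_of_neg (by linarith)]; linarith [hz.1]
    have h2 := hdown x hx (q - x) fun z hz h => by
      have := (hm.lt_iff_gt hz hx).1 h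
      rw [abs_of_pos (by linarith)]; linarith [hz.2]
    exact ⟨by rw [abs_of_neg (by linarith [hx1.2])]; linarith,
      by rw [abs_of_pos (by linarith [hx1.1])]; linarith⟩

namespace IsFullBranchMap

variable {d : ℕ} {c : ℕ → ℝ} {T : ℝ → ℝ} {K : ℝ}

lemma strictMono (h : IsFullBranchMap d c T K) {i j : ℕ} (hij : i < j) (hj : j ≤ d) :
    c i < c j := by
  induction j, hij using Nat.le_induction with
  | base => exact h.lt_succ i hj
  | succ j _ ih => exact (ih (by omega)).trans (h.lt_succ j hj)

lemma mono (h : IsFullBranchMap d c T K) {i j : ℕ} (hij : i ≤ j) (hj : j ≤ d) : c i ≤ c j := by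
  rcases hij.eq_or_lt with rfl | hij
  · exact le_rfl
  · exact (h.strictMono hij hj).le

lemma neg_one_le (h : IsFullBranchMap d c T K) {i : ℕ} (hi : i ≤ d) : -1 ≤ c i :=
  h.left.symm.trans_le (h.mono (Nat.zero_le i) hi)

lemma le_one (h : IsFullBranchMap d c T K) {i : ℕ} (hi : i ≤ d) : c i ≤ 1 :=
  (h.mono hi le_rfl).trans_eq h.right

lemma abs_le_one (h : IsFullBranchMap d c T K) {x : ℝ} (hx : x ∈ Set.Icc (-1 : ℝ) 1) :
    |T x| ≤ 1 := abs_le.2 (h.mapsTo hx)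

lemma mem_Icc (h : IsFullBranchMap d c T K) {i : ℕ} (hi : i < d) {x : ℝ}
    (hx : x ∈ Set.Ioo (c i) (c (i + 1))) : x ∈ Set.Icc (-1 : ℝ) 1 :=
  ⟨(h.neg_one_le hi.le).trans hx.1.le, hx.2.le.trans (h.le_one hi)⟩

lemma notMem_image (h : IsFullBranchMap d c T K) {i : ℕ} (hi : i < d) {x : ℝ}
    (hx : x ∈ Set.Ioo (c i) (c (i + 1))) : x ∉ c '' Set.Ioo 0 d := by
  rintro ⟨j, hj, rfl⟩
  rcases Nat.lt_or_ge i j with hij | hij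
  · exact absurd hx.2 (h.mono hij hj.2.le).not_gt
  · exact absurd hx.1 (h.mono hij hi.le).not_gt

lemma abs_sub_le (h : IsFullBranchMap d c T K) {i : ℕ} (hi : i < d) {x y : ℝ}
    (hx : x ∈ Set.Ioo (c i) (c (i + 1))) (hy : y ∈ Set.Ioo (c i) (c (i + 1))) :
    |T x - T y| ≤ K * |x - y| :=
  Convex.norm_image_sub_le_of_norm_deriv_le (s := Set.Ioo (c i) (c (i + 1)))
    (fun z hz => (h.analytic i hi z hz).differentiableAt)
    (fun z hz => h.deriv_le z ⟨h.mem_Icc hi hz, h.notMem_image hi hz⟩) (convex_Ioo _ _) hy hx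

lemma nonneg (h : IsFullBranchMap d c T K) : 0 ≤ K :=
  (abs_nonneg _).trans (h.deriv_le (-1) ⟨by norm_num, by
    rintro ⟨j, hj, hj'⟩
    have := h.strictMono hj.1 hj.2.le
    rw [h.left, hj'] at this
    exact lt_irrefl _ this⟩)

lemma exists_ends (h : IsFullBranchMap d c T K) {i : ℕ} (hi : i < d) :
    ∃ a : ℝ, (a = 1 ∨ a = -1) ∧ ∀ x ∈ Set.Ioo (c i) (c (i + 1)),
      |T x - a| ≤ K * (x - c i) ∧ |T x + a| ≤ K * (c (i + 1) - x) :=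
  exists_end_values (h.lt_succ i hi) (h.analytic i hi).continuousOn (h.bijOn i hi) h.nonneg
    fun _ hx _ hy => h.abs_sub_le hi hx hy

lemma two_le (h : IsFullBranchMap d c T K) {i : ℕ} (hi : i < d) :
    2 ≤ K * (c (i + 1) - c i) := by
  obtain ⟨a, ha, hb⟩ := h.exists_ends hi
  obtain ⟨x, hx⟩ := exists_between (h.lt_succ i hi)
  obtain ⟨h1, h2⟩ := hb x hx
  rcases ha with rfl | rfl
  · linarith [neg_abs_le (T x - 1), le_abs_self (T x + 1)]
  · linarith [le_abs_self (T x - -1), neg_abs_le (T x + -1)]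

lemma natCast_le (h : IsFullBranchMap d c T K) : (d : ℝ) ≤ K := by
  have h1 : ∑ i ∈ Finset.range d, (2 : ℝ) ≤ ∑ i ∈ Finset.range d, K * (c (i + 1) - c i) :=
    Finset.sum_le_sum fun i hi => h.two_le (Finset.mem_range.1 hi)
  rw [← Finset.mul_sum, Finset.sum_range_sub, h.left, h.right, Finset.sum_const,
    Finset.card_range, nsmul_eq_mul] at h1
  linarith

lemma exists_branch (h : IsFullBranchMap d c T K) {x : ℝ} (h1 : -1 < x) (h2 : x < 1)
    (hx : x ∉ c '' Set.Ioo 0 d) : ∃ i < d, x ∈ Set.Ioo (c i) (c (i + 1)) := by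
  have hex : ∃ j, x < c j := ⟨d, by rwa [h.right]⟩
  classical
  have hj := Nat.find_spec hex
  have hmin := fun m => Nat.find_min hex (m := m)
  have hjd : Nat.find hex ≤ d := Nat.find_min' hex (by rwa [h.right])
  obtain ⟨i, hi⟩ : ∃ i, Nat.find hex = i + 1 := Nat.exists_eq_succ_of_ne_zero fun h0 => by
    rw [h0, h.left] at hj
    exact lt_asymm h1 hj
  rw [hi] at hj hjd
  refine ⟨i, hjd, lt_of_le_of_ne (not_lt.1 (hmin i (by omega))) fun he => ?_, hj⟩
  rcases Nat.eq_zero_or_pos i with rfl | hi0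
  · rw [h.left] at he; exact h1.ne he
  · exact hx ⟨i, ⟨hi0, hjd⟩, he⟩

/-- The critical points. -/
noncomputable def crit (d : ℕ) (c : ℕ → ℝ) : Finset ℝ := (Finset.Ioo 0 d).image c

/-- The critical points and the endpoints of `[-1, 1]`. -/
noncomputable def bad (d : ℕ) (c : ℕ → ℝ) : Finset ℝ := insert (-1) (insert 1 (crit d c))

lemma mem_crit {x : ℝ} : x ∈ crit d c ↔ x ∈ c '' Set.Ioo 0 d := by
  simp [crit]

lemma card_crit_le (hd : 0 < d) : ((crit d c).card : ℝ) ≤ d - 1 := by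
  have h : (crit d c).card ≤ d - 1 := Finset.card_image_le.trans (by simp)
  have : ((crit d c).card : ℝ) ≤ (d - 1 : ℕ) := by exact_mod_cast h
  rwa [Nat.cast_pred hd] at this

lemma exists_branch_of_notMem_bad (h : IsFullBranchMap d c T K) {x : ℝ}
    (hx : x ∈ Set.Icc (-1 : ℝ) 1) (hb : x ∉ bad d c) : ∃ i < d, x ∈ Set.Ioo (c i) (c (i + 1)) := by
  simp only [bad, Finset.mem_insert, not_or, mem_crit] at hb
  exact h.exists_branch (lt_of_le_of_ne hx.1 (Ne.symm hb.1)) (lt_of_le_of_ne hx.2 hb.2.1) hb.2.2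

/-- Two points outside `bad` lie in one branch unless a critical point separates them. -/
lemma lipschitz_or_separated (h : IsFullBranchMap d c T K) {x y : ℝ}
    (hx : x ∈ Set.Icc (-1 : ℝ) 1) (hy : y ∈ Set.Icc (-1 : ℝ) 1) (hxb : x ∉ bad d c)
    (hyb : y ∉ bad d c) (hxy : x < y) :
    |T x - T y| ≤ K * (y - x) ∨ 1 ≤ ((crit d c).filter (· ∈ Set.Ioo x y)).card := by
  obtain ⟨i, hi, hxi⟩ := h.exists_branch_of_notMem_bad hx hxb
  rcases lt_or_ge y (c (i + 1)) with hyc | hyc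
  · left
    have := h.abs_sub_le hi hxi ⟨hxi.1.trans hxy, hyc⟩
    rwa [abs_sub_comm x y, abs_of_pos (sub_pos.2 hxy)] at this
  · right
    simp only [bad, Finset.mem_insert, not_or, mem_crit] at hyb
    have hid : i + 1 < d := lt_of_le_of_ne hi fun he => by
      rw [he, h.right] at hyc
      exact hyb.2.1 (le_antisymm hy.2 hyc)
    have hmem : c (i + 1) ∈ c '' Set.Ioo 0 d := ⟨i + 1, ⟨i.succ_pos, hid⟩, rfl⟩
    have hne : c (i + 1) ≠ y := fun he => hyb.2.2 (he ▸ hmem)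
    exact Finset.card_pos.2 ⟨c (i + 1), Finset.mem_filter.2
      ⟨mem_crit.2 hmem, hxi.2, lt_of_le_of_ne hyc hne⟩⟩

lemma abs_monomial_le_one (h : IsFullBranchMap d c T K) (k l : ℕ) {x : ℝ}
    (hx : x ∈ Set.Icc (-1 : ℝ) 1) : |T x ^ k * x ^ l| ≤ 1 := by
  rw [abs_mul, abs_pow, abs_pow]
  exact mul_le_one₀ (pow_le_one₀ (abs_nonneg _) (h.abs_le_one hx)) (by positivity)
    (pow_le_one₀ (abs_nonneg _) (abs_le.2 hx))

end IsFullBranchMap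

lemma abs_pow_sub_pow_le_of_abs_le_one {a b : ℝ} (ha : |a| ≤ 1) (hb : |b| ≤ 1) (n : ℕ) :
    |a ^ n - b ^ n| ≤ n * |a - b| := by
  refine (abs_pow_sub_pow_le a b n).trans ?_
  have h1 : max |a| |b| ^ (n - 1) ≤ 1 :=
    pow_le_one₀ (le_max_of_le_left (abs_nonneg _)) (max_le ha hb)
  calc _ ≤ |a - b| * n * 1 := by gcongr
    _ = _ := by ring

lemma abs_pow_mul_pow_sub_le {a b x y : ℝ} (ha : |a| ≤ 1) (hb : |b| ≤ 1) (hx : |x| ≤ 1)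
    (hy : |y| ≤ 1) (k l : ℕ) :
    |a ^ k * x ^ l - b ^ k * y ^ l| ≤ k * |a - b| + l * |x - y| := by
  have e : a ^ k * x ^ l - b ^ k * y ^ l = (a ^ k - b ^ k) * x ^ l + b ^ k * (x ^ l - y ^ l) := by
    ring
  rw [e]
  refine (abs_add_le _ _).trans ?_
  rw [abs_mul, abs_mul, abs_pow x, abs_pow b]
  have h1 : |x| ^ l ≤ 1 := pow_le_one₀ (abs_nonneg _) hx
  have h2 : |b| ^ k ≤ 1 := pow_le_one₀ (abs_nonneg _) hb
  exact add_le_add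
    ((mul_le_of_le_one_right (abs_nonneg _) h1).trans (abs_pow_sub_pow_le_of_abs_le_one ha hb k))
    ((mul_le_of_le_one_left (abs_nonneg _) h2).trans (abs_pow_sub_pow_le_of_abs_le_one hx hy l))

namespace IsFullBranchMap

variable {d : ℕ} {c : ℕ → ℝ} {T : ℝ → ℝ} {K : ℝ}

lemma lipschitzWithJumps_monomial (h : IsFullBranchMap d c T K) (k l : ℕ) :
    LipschitzWithJumps (fun x => T x ^ k * x ^ l) (bad d c) (crit d c) (K * k + l) 2 := by
  intro x hx y hy hxb hyb hxy
  have hK := h.nonneg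
  have hpos : 0 < y - x := sub_pos.2 hxy
  rcases h.lipschitz_or_separated hx hy hxb hyb hxy with hl | hs
  · have := abs_pow_mul_pow_sub_le (h.abs_le_one hx) (h.abs_le_one hy) (abs_le.2 hx) (abs_le.2 hy)
      k l
    rw [abs_sub_comm x y, abs_of_pos hpos] at this
    have h1 : (k : ℝ) * |T x - T y| ≤ k * (K * (y - x)) := by gcongr
    have h2 : (0 : ℝ) ≤ 2 * ((crit d c).filter (· ∈ Set.Ioo x y)).card := by positivity
    linarith
  · have h1 : |T x ^ k * x ^ l - T y ^ k * y ^ l| ≤ 2 := by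
      refine (abs_sub _ _).trans ?_
      linarith [h.abs_monomial_le_one k l hx, h.abs_monomial_le_one k l hy]
    have h2 : (1 : ℝ) ≤ ((crit d c).filter (· ∈ Set.Ioo x y)).card := by exact_mod_cast hs
    have h3 : 0 ≤ (K * k + l) * (y - x) := by positivity
    show |T x ^ k * x ^ l - T y ^ k * y ^ l| ≤ _
    linarith

lemma lipschitzWithJumps_pow (l : ℕ) (J : ℝ) :
    LipschitzWithJumps (fun x => x ^ l) ∅ ∅ l J := by
  intro x hx y hy _ _ hxy
  have := abs_pow_sub_pow_le_of_abs_le_one (abs_le.2 hx) (abs_le.2 hy) l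
  rw [abs_sub_comm x y, abs_of_pos (sub_pos.2 hxy)] at this
  simpa using this

lemma intervalIntegrable_monomial (h : IsFullBranchMap d c T K) (k l : ℕ) :
    IntervalIntegrable (fun x => T x ^ k * x ^ l) MeasureTheory.volume (-1) 1 := by
  rw [← h.left, ← h.right]
  refine IntervalIntegrable.trans_iterate fun i hi => ?_
  rw [intervalIntegrable_iff_integrableOn_Ioo_of_le (h.lt_succ i hi).le]
  have hc : ContinuousOn (fun x => T x ^ k * x ^ l) (Set.Ioo (c i) (c (i + 1))) :=
    ((h.analytic i hi).continuousOn.pow k).mul (continuousOn_id.pow l)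
  refine MeasureTheory.IntegrableOn.of_bound (by simp)
    (hc.aestronglyMeasurable measurableSet_Ioo) 1 ?_
  filter_upwards [MeasureTheory.ae_restrict_mem measurableSet_Ioo] with x hx
  exact h.abs_monomial_le_one k l (h.mem_Icc hi hx)

lemma abs_sub_le_left (h : IsFullBranchMap d c T K) {a : ℝ} (ha : a = 1 ∨ a = -1)
    (hends : ∀ x ∈ Set.Ioo (c 0) (c (0 + 1)), |T x - a| ≤ K * (x - c 0)) {x : ℝ}
    (hx : x ∈ Set.Ioc (-1 : ℝ) 1) : |T x - a| ≤ K * (x + 1) := by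
  rcases lt_or_ge x (c (0 + 1)) with hxc | hxc
  · have := hends x ⟨by rw [h.left]; exact hx.1, hxc⟩
    rwa [h.left, sub_neg_eq_add] at this
  · have h1 := h.two_le h.pos
    rw [h.left] at h1
    have h2 : K * c (0 + 1) ≤ K * x := mul_le_mul_of_nonneg_left hxc h.nonneg
    have h3 : |T x - a| ≤ 2 := by
      refine (abs_sub _ _).trans ?_
      have := h.abs_le_one ⟨hx.1.le, hx.2⟩
      rcases ha with rfl | rfl <;> norm_num <;> linarith
    linarith

lemma abs_add_le_right (h : IsFullBranchMap d c T K) {j : ℕ} (hj : j + 1 = d) {b : ℝ}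
    (hb : b = 1 ∨ b = -1)
    (hends : ∀ x ∈ Set.Ioo (c j) (c (j + 1)), |T x + b| ≤ K * (c (j + 1) - x)) {x : ℝ}
    (hx : x ∈ Set.Ico (-1 : ℝ) 1) : |T x + b| ≤ K * (1 - x) := by
  have hcj : c (j + 1) = 1 := by rw [hj, h.right]
  rcases lt_or_ge (c j) x with hxc | hxc
  · have := hends x ⟨hxc, by rw [hcj]; exact hx.2⟩
    rwa [hcj] at this
  · have h1 := h.two_le (i := j) (by omega)
    rw [hcj] at h1
    have h2 : K * x ≤ K * c j := mul_le_mul_of_nonneg_left hxc h.nonneg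
    have h3 : |T x + b| ≤ 2 := by
      refine (abs_add_le _ _).trans ?_
      have := h.abs_le_one ⟨hx.1, hx.2.le⟩
      rcases hb with rfl | rfl <;> norm_num <;> linarith
    linarith

lemma abs_end_cell_le (h : IsFullBranchMap d c T K) (k l : ℕ) {t v : ℝ} (ht0 : 0 ≤ t) (ht1 : t ≤ 1)
    (hv : |v| ≤ 1) :
    |(∫ x in (-1 : ℝ)..(-1 + t), T x ^ k * x ^ l) + (∫ x in (1 - t)..1, T x ^ k * x ^ l)
      - 2 * t * v| ≤ 2 * t * 2 := by
  have h1 : |∫ x in (-1 : ℝ)..(-1 + t), T x ^ k * x ^ l| ≤ 1 * |-1 + t - -1| := by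
    rw [← Real.norm_eq_abs]
    refine intervalIntegral.norm_integral_le_of_norm_le_const fun x hx => ?_
    rw [Set.uIoc_of_le (by linarith : (-1 : ℝ) ≤ -1 + t)] at hx
    exact h.abs_monomial_le_one k l ⟨hx.1.le, by linarith [hx.2]⟩
  have h2 : |∫ x in (1 - t)..1, T x ^ k * x ^ l| ≤ 1 * |1 - (1 - t)| := by
    rw [← Real.norm_eq_abs]
    refine intervalIntegral.norm_integral_le_of_norm_le_const fun x hx => ?_
    rw [Set.uIoc_of_le (by linarith : 1 - t ≤ 1)] at hx
    exact h.abs_monomial_le_one k l ⟨by linarith [hx.1], hx.2⟩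
  rw [show -1 + t - -1 = t by ring, abs_of_nonneg ht0] at h1
  rw [show 1 - (1 - t) = t by ring, abs_of_nonneg ht0] at h2
  have h3 : |2 * t * v| ≤ 2 * t := by
    rw [abs_mul, abs_of_nonneg (by positivity : 0 ≤ 2 * t)]
    exact mul_le_of_le_one_right (by positivity) hv
  refine (abs_sub _ _).trans ?_
  linarith [abs_add_le (∫ x in (-1 : ℝ)..(-1 + t), T x ^ k * x ^ l)
    (∫ x in (1 - t)..1, T x ^ k * x ^ l)]

end IsFullBranchMap

/-- Contribution of the two half cells at the ends of `[-1, 1]` for a function that approaches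
`a` at `-1` and `-b` at `1` at linear rate. -/
lemma abs_end_cell_le_of_linear_rate {g : ℝ → ℝ} {a b K t v : ℝ} (ht0 : 0 ≤ t) (ht1 : t ≤ 1)
    (hg : IntervalIntegrable g MeasureTheory.volume (-1) 1)
    (hl : ∀ x ∈ Set.Ioc (-1 : ℝ) 1, |g x - a| ≤ K * (x + 1))
    (hr : ∀ x ∈ Set.Ico (-1 : ℝ) 1, |g x + b| ≤ K * (1 - x)) (hv : |v| ≤ 1) :
    |(∫ x in (-1 : ℝ)..(-1 + t), g x) + (∫ x in (1 - t)..1, g x) - 2 * t * v| ≤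
      2 * t * (1 + |a - b| / 2 + K * t / 2) := by
  have hsub : ∀ p q : ℝ, -1 ≤ p → p ≤ q → q ≤ 1 →
      IntervalIntegrable g MeasureTheory.volume p q := by
    intro p q h1 h2 h3
    refine hg.mono_set ?_
    rw [Set.uIcc_of_le h2, Set.uIcc_of_le (by norm_num)]
    exact Set.Icc_subset_Icc h1 h3
  have h1 : |∫ x in (-1 : ℝ)..(-1 + t), (g x - a)| ≤ ∫ x in (-1 : ℝ)..(-1 + t), K * (x + 1) := by
    rw [← Real.norm_eq_abs]
    exact intervalIntegral.norm_integral_le_of_norm_le (by linarith)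
      (Filter.Eventually.of_forall fun x hx => hl x ⟨hx.1, by linarith [hx.2]⟩)
      ((by fun_prop : Continuous fun x : ℝ => K * (x + 1)).intervalIntegrable _ _)
  have h2 : |∫ x in (1 - t)..1, (g x + b)| ≤ ∫ x in (1 - t)..1, K * (1 - x) := by
    rw [← Real.norm_eq_abs]
    refine intervalIntegral.norm_integral_le_of_norm_le (by linarith) ?_
      ((by fun_prop : Continuous fun x : ℝ => K * (1 - x)).intervalIntegrable _ _)
    have hne : ∀ᵐ x : ℝ, x ≠ 1 := by
      simpa using (Set.countable_singleton (1 : ℝ)).ae_notMem MeasureTheory.volume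
    filter_upwards [hne] with x hx1 hx
    exact hr x ⟨by linarith [hx.1], lt_of_le_of_ne hx.2 hx1⟩
  rw [intervalIntegral.integral_sub (hsub (-1) (-1 + t) le_rfl (by linarith) (by linarith)) (by simp),
    intervalIntegral.integral_const_mul, intervalIntegral.integral_add (by simp) (by simp)] at h1
  rw [intervalIntegral.integral_add (hsub (1 - t) 1 (by linarith) (by linarith) le_rfl) (by simp),
    intervalIntegral.integral_const_mul, intervalIntegral.integral_sub (by simp) (by simp)] at h2
  simp only [intervalIntegral.integral_const, integral_id, smul_eq_mul] at h1 h2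
  set I := ∫ x in (-1 : ℝ)..(-1 + t), g x
  set I' := ∫ x in (1 - t)..1, g x
  have e : I + I' - 2 * t * v = (I - (-1 + t - -1) * a) + (I' + (1 - (1 - t)) * b) +
      (t * (a - b) - 2 * t * v) := by ring
  have h3 : |t * (a - b) - 2 * t * v| ≤ t * |a - b| + 2 * t := by
    refine (abs_sub _ _).trans ?_
    rw [abs_mul, abs_mul, abs_of_nonneg ht0, abs_of_nonneg (by positivity : 0 ≤ 2 * t)]
    have := mul_le_of_le_one_right (by positivity : 0 ≤ 2 * t) hv
    linarith
  rw [e]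
  refine (abs_add_three _ _ _).trans ?_
  calc _ ≤ _ := add_le_add (add_le_add h1 h2) h3
    _ = _ := by ring

namespace IsFullBranchMap

variable {d : ℕ} {c : ℕ → ℝ} {T : ℝ → ℝ} {K : ℝ}

/-- For at most two branches, the jump of `T` is governed by the end values of the branches. -/
lemma exists_jump_data (h : IsFullBranchMap d c T K) (hd : d ≤ 2) :
    ∃ a b J : ℝ, 0 ≤ J ∧ J * (crit d c).card + 1 + |a - b| / 2 ≤ 3 / 2 * K ∧
      (∀ x ∈ Set.Ioc (-1 : ℝ) 1, |T x - a| ≤ K * (x + 1)) ∧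
      (∀ x ∈ Set.Ico (-1 : ℝ) 1, |T x + b| ≤ K * (1 - x)) ∧
      LipschitzWithJumps T (bad d c) (crit d c) K J := by
  have hdK := h.natCast_le
  have hd0 := h.pos
  have hK := h.nonneg
  have hcard := card_crit_le (c := c) h.pos
  obtain ⟨a, ha, hae⟩ := h.exists_ends h.pos
  have hL := fun x (hx : x ∈ Set.Ioc (-1 : ℝ) 1) =>
    h.abs_sub_le_left ha (fun x hx => (hae x hx).1) hx
  obtain rfl | rfl : d = 1 ∨ d = 2 := by omega
  · refine ⟨a, a, 2, by norm_num, ?_, hL, fun x hx =>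
      h.abs_add_le_right rfl ha (fun x hx => (hae x hx).2) hx, ?_⟩
    · simp only [sub_self, abs_zero, Nat.cast_one] at hcard hdK ⊢
      linarith
    · simpa using h.lipschitzWithJumps_monomial 1 0
  · obtain ⟨b, hb, hbe⟩ := h.exists_ends (i := 1) (by norm_num)
    refine ⟨a, b, |a + b|, abs_nonneg _, ?_, hL, fun x hx =>
      h.abs_add_le_right rfl hb (fun x hx => (hbe x hx).2) hx, ?_⟩
    · have h1 : |a + b| * (crit 2 c).card ≤ |a + b| * 1 :=
        mul_le_mul_of_nonneg_left (by norm_num at hcard ⊢; exact hcard) (abs_nonneg _)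
      have h2 : |a + b| + |a - b| / 2 ≤ 2 := by
        rcases ha with rfl | rfl <;> rcases hb with rfl | rfl <;> norm_num
      norm_num at hdK
      linarith
    · intro x hx y hy hxb hyb hxy
      have hJ : 0 ≤ |a + b| * ((crit 2 c).filter (· ∈ Set.Ioo x y)).card := by positivity
      rcases h.lipschitz_or_separated hx hy hxb hyb hxy with hl | hs
      · linarith
      · obtain ⟨i, hi, hxi⟩ := h.exists_branch_of_notMem_bad hx hxb
        obtain ⟨j, hj, hyj⟩ := h.exists_branch_of_notMem_bad hy hyb
        obtain ⟨z, hz⟩ := Finset.card_pos.1 hs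
        rw [Finset.mem_filter, mem_crit] at hz
        obtain ⟨⟨s, hs, rfl⟩, hz⟩ := hz
        obtain rfl : s = 1 := by have := hs.1; have := hs.2; omega
        have hi0 : i = 0 := by
          by_contra hne
          obtain rfl : i = 1 := by omega
          exact lt_asymm hxi.1 hz.1
        have hj1 : j = 1 := by
          by_contra hne
          obtain rfl : j = 0 := by omega
          exact lt_asymm hyj.2 hz.2
        subst hi0 hj1
        have e1 := (hae x hxi).2
        have e2 := (hbe y hyj).1
        have e3 : (1 : ℝ) ≤ ((crit 2 c).filter (· ∈ Set.Ioo x y)).card := by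
          exact_mod_cast ‹1 ≤ ((crit 2 c).filter (· ∈ Set.Ioo x y)).card›
        have e4 := le_mul_of_one_le_right (abs_nonneg (a + b)) e3
        have e5 : T x - T y = (T x + a) + -(a + b) + -(T y - b) := by ring
        rw [e5]
        refine (abs_add_three _ _ _).trans ?_
        rw [abs_neg, abs_neg]
        simp only [zero_add] at e1
        linarith

/-- Quadrature error when one node is an endpoint of `[-1, 1]`. -/
lemma endpoint_error (h : IsFullBranchMap d c T K) (n : ℕ)
    (hy : ∀ m < n, (-1 + 2 * ((m : ℝ) + 1) / (n + 1)) ∉ c '' Set.Ioo 0 d) {k : ℕ} (hk : 0 < k)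
    (l : ℕ) {e : ℝ} (he : e ∈ Set.Icc (-1 : ℝ) 1) :
    |1 / 2 * (∫ x in (-1 : ℝ)..1, T x ^ k * x ^ l) -
        1 / (n + 1) * (∑ m ∈ Finset.range n, T (-1 + 2 * (m + 1) / (n + 1)) ^ k *
          (-1 + 2 * (m + 1) / (n + 1)) ^ l + T e ^ k * e ^ l)| ≤
      max K (2 * ((d : ℝ) - 1)) * (k + l + 1) / (n + 1) := by
  have hn : (0 : ℝ) < n + 1 := by positivity
  have hyb : ∀ m < n, (-1 + 2 * ((m : ℝ) + 1) / (n + 1)) ∉ bad d c := by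
    intro m hm
    have hm' : (m : ℝ) + 1 ≤ n := by exact_mod_cast hm
    simp only [bad, Finset.mem_insert, not_or, mem_crit]
    refine ⟨ne_of_gt ?_, ne_of_lt ?_, hy m hm⟩
    · have : 0 < 2 * ((m : ℝ) + 1) / (n + 1) := by positivity
      linarith
    · have : 2 * ((m : ℝ) + 1) / (n + 1) < 2 := by rw [div_lt_iff₀ hn]; linarith
      linarith
  have ht0 : 0 ≤ 1 / ((n : ℝ) + 1) := by positivity
  have ht1 : 1 / ((n : ℝ) + 1) ≤ 1 := by
    rw [div_le_one hn]; linarith [(Nat.cast_nonneg n : (0 : ℝ) ≤ n)]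
  have hv := h.abs_monomial_le_one k l he
  have hdK := h.natCast_le
  have hK := h.nonneg
  have hcard := card_crit_le (c := c) h.pos
  have hd1 : (1 : ℝ) ≤ d := by exact_mod_cast h.pos
  have hn1 : (n : ℝ) / (n + 1) = 1 - 1 / (n + 1) := by field_simp; ring
  have hA1 := le_max_left K (2 * ((d : ℝ) - 1))
  have hA2 := le_max_right K (2 * ((d : ℝ) - 1))
  set A := max K (2 * ((d : ℝ) - 1))
  have h2t : 2 / ((n : ℝ) + 1) = 2 * (1 / (n + 1)) := by ring
  by_cases hcase : d ≤ 2 ∧ k + l ≤ 1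
  · obtain ⟨hd2, hkl⟩ := hcase
    obtain rfl : k = 1 := by omega
    obtain rfl : l = 0 := by omega
    obtain ⟨a, b, J, hJ, hbd, hl, hr, hlip⟩ := h.exists_jump_data hd2
    have hgi := h.intervalIntegrable_monomial 1 0
    simp only [pow_one, pow_zero, mul_one] at hv hgi ⊢
    have hcell := abs_end_cell_le_of_linear_rate ht0 ht1 hgi hl hr hv
    rw [← h2t] at hcell
    refine (hlip.midpoint_error hK hJ hgi n hyb hcell).trans ?_
    gcongr
    rw [hn1]
    push_cast
    linarith
  · have hcell := h.abs_end_cell_le k l ht0 ht1 hv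
    rw [← h2t] at hcell
    refine ((h.lipschitzWithJumps_monomial k l).midpoint_error (by positivity) (by norm_num)
      (h.intervalIntegrable_monomial k l) n hyb hcell).trans ?_
    gcongr
    have hk1 : (1 : ℝ) ≤ k := by exact_mod_cast hk
    have hl0 : (0 : ℝ) ≤ l := Nat.cast_nonneg l
    have h1 : (n : ℝ) / (n + 1) * ((K * k + l) / 2) ≤ A * (k + l) / 2 := by
      have e1 : (n : ℝ) / (n + 1) ≤ 1 := by rw [hn1]; linarith
      have e2 : K * k + l ≤ A * (k + l) := by nlinarith
      refine (mul_le_of_le_one_left (by positivity) e1).trans ?_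
      linarith
    have h2 : 2 * (d : ℝ) ≤ A * (k + l) / 2 + A := by
      rcases Nat.lt_or_ge 1 (k + l) with hs | hs
      · have hs' : (2 : ℝ) ≤ k + l := by exact_mod_cast hs
        nlinarith
      · have hd3 : (3 : ℝ) ≤ d := by exact_mod_cast (by omega : 3 ≤ d)
        nlinarith
    linarith

end IsFullBranchMap


/-- Collocation error for the entries of the EDMD matrix `Ĝ` built from monomial
observables and equidistant nodes, for an analytic full branch map `T` on `[-1,1]`
with `d` branches and critical-point set `S = {c_1, …, c_{d-1}}`
(second half of Proposition 7 of the paper). -/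
theorem edmd_G_matrix_collocation_error
    (d : ℕ) (hd : 0 < d) (c : ℕ → ℝ)
    (hc0 : c 0 = -1) (hcd : c d = 1) (hc : ∀ i < d, c i < c (i + 1))
    (T : ℝ → ℝ)
    (hT : Set.MapsTo T (Set.Icc (-1 : ℝ) 1) (Set.Icc (-1 : ℝ) 1))
    (hTan : ∀ ℓ < d, AnalyticOnNhd ℝ T (Set.Ioo (c ℓ) (c (ℓ + 1))))
    (hTbij : ∀ ℓ < d, Set.BijOn T (Set.Ioo (c ℓ) (c (ℓ + 1))) (Set.Ioo (-1 : ℝ) 1))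
    (K : ℝ)
    (hK : ∀ x ∈ Set.Icc (-1 : ℝ) 1 \ (c '' Set.Ioo 0 d), |deriv T x| ≤ K)
    (M : ℕ) (hM : 0 < M) (δ : ℝ) (hδ0 : 0 ≤ δ) (hδ : δ ≤ 2 / M)
    (hnodes : ∀ m < M, (-1 + δ + 2 * (m : ℝ) / M) ∉ c '' Set.Ioo 0 d)
    (k l : ℕ) :
    |1 / 2 * (∫ x in (-1 : ℝ)..1, T x ^ k * x ^ l) -
        1 / M * ∑ m ∈ Finset.range M,
          T (-1 + δ + 2 * m / M) ^ k * (-1 + δ + 2 * m / M) ^ l| ≤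
      max K (2 * ((d : ℝ) - 1)) * (k + l + 1) / M := by
  have h : IsFullBranchMap d c T K := ⟨hd, hc0, hcd, hc, hT, hTan, hTbij, hK⟩
  have hM' : (0 : ℝ) < M := by exact_mod_cast hM
  have hK0 := h.nonneg
  have hd1 : (1 : ℝ) ≤ d := by exact_mod_cast hd
  have hA1 := le_max_left K (2 * ((d : ℝ) - 1))
  have hA2 := le_max_right K (2 * ((d : ℝ) - 1))
  have hKd := h.natCast_le
  rcases Nat.eq_zero_or_pos k with rfl | hk
  · have key := (IsFullBranchMap.lipschitzWithJumps_pow l 0).rectangle_error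
      (Nat.cast_nonneg l) le_rfl ((continuous_pow l).intervalIntegrable _ _) hM hδ0 hδ (by simp)
    simp only [pow_zero, one_mul]
    refine key.trans ?_
    gcongr
    have hl0 : (0 : ℝ) ≤ l := Nat.cast_nonneg l
    push_cast
    nlinarith
  by_cases hend : δ = 0 ∨ δ = 2 / M
  · obtain ⟨n, rfl⟩ : ∃ n, M = n + 1 := ⟨M - 1, by omega⟩
    push_cast at *
    rcases hend with rfl | rfl
    · have key := h.endpoint_error n (fun m hm => by
        have := hnodes (m + 1) (by omega)
        push_cast at this
        rwa [add_zero] at this) hk l (e := -1) (by norm_num)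
      rw [Finset.sum_range_succ']
      simpa using key
    · have hnode : ∀ m : ℕ, -1 + 2 / ((n : ℝ) + 1) + 2 * m / (n + 1) =
          -1 + 2 * (m + 1) / (n + 1) := fun m => by ring
      have key := h.endpoint_error n (fun m hm => by
        rw [← hnode]
        exact hnodes m (by omega)) hk l (e := 1) (by norm_num)
      rw [Finset.sum_range_succ]
      have hlast : -1 + 2 * ((n : ℝ) + 1) / (n + 1) = 1 := by field_simp; norm_num
      simp only [hnode, hlast]
      exact key
  · rw [not_or] at hend
    have hδ1 : 0 < δ := lt_of_le_of_ne hδ0 (Ne.symm hend.1)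
    have hδ2 : δ < 2 / M := lt_of_le_of_ne hδ hend.2
    have key := (h.lipschitzWithJumps_monomial k l).rectangle_error (by positivity)
      (by norm_num) (h.intervalIntegrable_monomial k l) hM hδ0 hδ (fun m hm => by
        have hm' : (m : ℝ) + 1 ≤ M := by exact_mod_cast hm
        simp only [IsFullBranchMap.bad, Finset.mem_insert, not_or, IsFullBranchMap.mem_crit]
        refine ⟨ne_of_gt ?_, ne_of_lt ?_, hnodes m hm⟩
        · have : 0 ≤ 2 * (m : ℝ) / M := by positivity
          linarith
        · have : 2 / M + 2 * (m : ℝ) / M ≤ 2 := by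
            rw [← add_div, div_le_iff₀ hM']; linarith
          linarith)
    refine key.trans ?_
    gcongr
    have hcard := IsFullBranchMap.card_crit_le (c := c) hd
    have hk0 : (0 : ℝ) ≤ k := Nat.cast_nonneg k
    have hl0 : (0 : ℝ) ≤ l := Nat.cast_nonneg l
    nlinarith
end

section
/- Let T be an analytic full branch map on [−1,1] with d branches, S its set of d−1 critical points, and ‖T'‖ = sup_{x∈[−1,1]∖S} |T'(x)|. Let M ∈ ℕ, 0 ≤ δ ≤ 2/M, nodes x_m = −1 + δ + 2m/M (m = 0,…,M−1) with no node in S, and let N ∈ ℕ. Then the spectral norms of the N×N difference matrices satisfy ‖Ĥ_N − Ĥ_N^{(M)}‖₂ ≤ (3/2)·N²/M and ‖Ĝ_N − Ĝ_N^{(M)}‖₂ ≤ (3/2)·max(‖T'‖, 2(d−1))·N²/M. -/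
open Finset in
/-- The spectral norm of a matrix is bounded by any bound on its Frobenius norm. -/
theorem norm_toEuclideanLin_le_of_sum_sq_le {N : ℕ} (A : Matrix (Fin N) (Fin N) ℝ) {R : ℝ}
    (hR : 0 ≤ R) (hA : ∑ k, ∑ l, A k l ^ 2 ≤ R ^ 2) (v : EuclideanSpace ℝ (Fin N)) :
    ‖Matrix.toEuclideanLin A v‖ ≤ R * ‖v‖ := by
  refine le_of_sq_le_sq ?_ (by positivity)
  rw [mul_pow, EuclideanSpace.norm_sq_eq, EuclideanSpace.norm_sq_eq]
  simp only [Real.norm_eq_abs, sq_abs, Matrix.toLpLin_apply, Matrix.mulVec, dotProduct]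
  calc ∑ k, (∑ l, A k l * v l) ^ 2 ≤ ∑ k, (∑ l, A k l ^ 2) * ∑ l, v l ^ 2 :=
        sum_le_sum fun k _ => sum_mul_sq_le_sq_mul_sq _ _ _
    _ = (∑ k, ∑ l, A k l ^ 2) * ∑ l, v l ^ 2 := (sum_mul ..).symm
    _ ≤ R ^ 2 * ∑ l, v l ^ 2 := by gcongr

/-- Size of the `(k, l)` collocation error, up to a factor depending on the map. -/
noncomputable def errorWeight (k l : ℕ) : ℝ := if k = 0 then l else k + l + 2

theorem sum_sq_errorWeight_le (N : ℕ) :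
    ∑ k ∈ Finset.range N, ∑ l ∈ Finset.range N, errorWeight k l ^ 2 ≤ (3 / 2 * (N : ℝ) ^ 2) ^ 2 := by
  have h1 (a : ℝ) (n : ℕ) : ∑ l ∈ Finset.range n, (a + l) ^ 2 =
      n * a ^ 2 + a * n * (n - 1) + (n - 1) * n * (2 * n - 1) / 6 := by
    induction n with
    | zero => simp
    | succ n ih => rw [Finset.sum_range_succ, ih]; push_cast; ring
  have h2 (n : ℕ) : ∑ k ∈ Finset.range (n + 1), ∑ l ∈ Finset.range N, errorWeight k l ^ 2 =
      (N - 1) * N * (2 * N - 1) / 6 * (n + 1) +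
      N * (n * (n + 1) * (2 * n + 1) / 6 + 2 * n * (n + 1) + 4 * n) +
      N * (N - 1) * (n * (n + 1) / 2 + 2 * n) := by
    induction n with
    | zero =>
      have := h1 0 N
      simp only [zero_add] at this
      simp [errorWeight, this]
    | succ n ih =>
      rw [Finset.sum_range_succ, ih]
      have (l : ℕ) : errorWeight (n + 1) l = ((n : ℝ) + 3) + l := by
        simp [errorWeight]; ring
      simp only [this, h1]
      push_cast; ring
  rcases N with _ | n
  · simp
  · rw [h2 n]
    push_cast
    have hn : (0 : ℝ) ≤ n := n.cast_nonneg
    have := mul_nonneg hn hn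
    have := mul_nonneg this hn
    have := mul_nonneg this hn
    ring_nf
    nlinarith

/-- Entrywise control by `errorWeight` gives a spectral norm bound. -/
theorem norm_toEuclideanLin_le_of_errorWeight {N : ℕ} (A : Matrix (Fin N) (Fin N) ℝ) {C : ℝ}
    (hC : 0 ≤ C) (hA : ∀ k l : Fin N, |A k l| ≤ C * errorWeight k l)
    (v : EuclideanSpace ℝ (Fin N)) :
    ‖Matrix.toEuclideanLin A v‖ ≤ C * (3 / 2 * (N : ℝ) ^ 2) * ‖v‖ := by
  refine norm_toEuclideanLin_le_of_sum_sq_le A (by positivity) ?_ v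
  calc ∑ k, ∑ l, A k l ^ 2 ≤ ∑ k : Fin N, ∑ l : Fin N, C ^ 2 * errorWeight k l ^ 2 := by
        gcongr with k _ l _
        rw [← mul_pow]
        exact sq_le_sq' (abs_le.1 (hA k l)).1 (abs_le.1 (hA k l)).2
    _ = C ^ 2 * ∑ k ∈ Finset.range N, ∑ l ∈ Finset.range N, errorWeight k l ^ 2 := by
        simp only [← Finset.mul_sum, Finset.sum_range]
    _ ≤ (C * (3 / 2 * (N : ℝ) ^ 2)) ^ 2 := by
        rw [mul_pow]
        gcongr
        exact sum_sq_errorWeight_le N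

theorem integral_abs_sub_le {a b x : ℝ} (hax : a ≤ x) (hxb : x ≤ b) :
    ∫ t in a..b, |t - x| ≤ (b - a) ^ 2 / 2 := by
  have hc : Continuous fun t : ℝ => |t - x| := by fun_prop
  rw [← intervalIntegral.integral_add_adjacent_intervals (hc.intervalIntegrable a x)
    (hc.intervalIntegrable x b)]
  have h1 : ∫ t in a..x, |t - x| = ∫ t in a..x, (x - t) := by
    refine intervalIntegral.integral_congr fun t ht => ?_
    rw [Set.uIcc_of_le hax] at ht
    simp only [abs_of_nonpos (sub_nonpos.2 ht.2), neg_sub]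
  have h2 : ∫ t in x..b, |t - x| = ∫ t in x..b, (t - x) := by
    refine intervalIntegral.integral_congr fun t ht => ?_
    rw [Set.uIcc_of_le hxb] at ht
    simp only [abs_of_nonneg (sub_nonneg.2 ht.1)]
  rw [h1, h2]
  rw [intervalIntegral.integral_sub intervalIntegrable_const
      (continuous_id'.intervalIntegrable _ _),
    intervalIntegral.integral_sub (continuous_id'.intervalIntegrable _ _)
      intervalIntegrable_const]
  simp only [intervalIntegral.integral_const, integral_id, smul_eq_mul]
  nlinarith [mul_nonneg (sub_nonneg.2 hax) (sub_nonneg.2 hxb)]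

/-- One-point quadrature error on a cell, from a pointwise bound in the open cell. -/
theorem abs_integral_sub_le_of_abs_sub_le {f g : ℝ → ℝ} {a b x : ℝ} (hab : a ≤ b)
    (hf : IntervalIntegrable f MeasureTheory.volume a b)
    (hg : Continuous g) (h : ∀ t ∈ Set.Ioo a b, |f t - f x| ≤ g t) :
    |(∫ t in a..b, f t) - (b - a) * f x| ≤ ∫ t in a..b, g t := by
  have : (∫ t in a..b, f t) - (b - a) * f x = ∫ t in a..b, (f t - f x) := by
    rw [intervalIntegral.integral_sub hf intervalIntegrable_const]
    simp
  rw [this]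
  refine (intervalIntegral.abs_integral_le_integral_abs hab).trans ?_
  exact intervalIntegral.integral_mono_on_of_le_Ioo hab
    (hf.sub intervalIntegrable_const).abs (hg.intervalIntegrable _ _) h

theorem abs_integral_sub_le_of_lipschitz {f : ℝ → ℝ} {a b x L : ℝ} (hL : 0 ≤ L) (hax : a ≤ x)
    (hxb : x ≤ b) (hf : IntervalIntegrable f MeasureTheory.volume a b)
    (h : ∀ t ∈ Set.Ioo a b, |f t - f x| ≤ L * |t - x|) :
    |(∫ t in a..b, f t) - (b - a) * f x| ≤ L * ((b - a) ^ 2 / 2) := by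
  refine (abs_integral_sub_le_of_abs_sub_le (hax.trans hxb) hf (by fun_prop) h).trans ?_
  rw [intervalIntegral.integral_const_mul]
  gcongr
  exact integral_abs_sub_le hax hxb

theorem abs_integral_sub_le_of_bounded {f : ℝ → ℝ} {a b x : ℝ} (hax : a ≤ x)
    (hxb : x ≤ b) (hf : IntervalIntegrable f MeasureTheory.volume a b)
    (h : ∀ t ∈ Set.Icc a b, |f t| ≤ 1) :
    |(∫ t in a..b, f t) - (b - a) * f x| ≤ 2 * (b - a) := by
  refine (abs_integral_sub_le_of_abs_sub_le (g := fun _ => 2) (hax.trans hxb) hf (by fun_prop)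
    fun t ht => ?_).trans ?_
  · have h1 := abs_le.1 (h t ⟨ht.1.le, ht.2.le⟩)
    have h2 := abs_le.1 (h x ⟨hax, hxb⟩)
    exact abs_le.2 ⟨by linarith, by linarith⟩
  · simp [mul_comm]

/-- Collocation error at equidistant nodes for a function bounded by one which is Lipschitz
on all cells outside a finite exceptional set `S`. -/
theorem abs_collocation_error_le {f : ℝ → ℝ} {M : ℕ} (hM : 0 < M) {δ : ℝ} (hδ0 : 0 ≤ δ)
    (hδ : δ ≤ 2 / M) (hf : IntervalIntegrable f MeasureTheory.volume (-1) 1)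
    (hf1 : ∀ t ∈ Set.Icc (-1 : ℝ) 1, |f t| ≤ 1) {L : ℝ} (hL : 0 ≤ L) (S : Finset ℕ)
    (h : ∀ m < M, m ∉ S → ∀ t ∈ Set.Ioo (-1 + 2 * (m : ℝ) / M) (-1 + 2 * ((m : ℝ) + 1) / M),
      |f t - f (-1 + δ + 2 * m / M)| ≤ L * |t - (-1 + δ + 2 * m / M)|) :
    |1 / 2 * (∫ t in (-1 : ℝ)..1, f t) - 1 / M * ∑ m ∈ Finset.range M, f (-1 + δ + 2 * m / M)| ≤
      (L + 2 * (S.card : ℝ)) / M := by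
  have hM' : (0 : ℝ) < M := by exact_mod_cast hM
  set a : ℕ → ℝ := fun m => -1 + 2 * (m : ℝ) / M with ha
  have ha0 : a 0 = -1 := by simp [ha]
  have haM : a M = 1 := by simp only [ha]; field_simp; norm_num
  have hstep (m : ℕ) : a (m + 1) - a m = 2 / M := by
    simp only [ha]; push_cast; field_simp; ring
  have hmono : Monotone a := monotone_nat_of_le_succ fun m => by
    have := hstep m
    have : 0 < 2 / (M : ℝ) := by positivity
    linarith
  have hsub (m : ℕ) (hm : m < M) : Set.Icc (a m) (a (m + 1)) ⊆ Set.Icc (-1) 1 :=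
    Set.Icc_subset_Icc (ha0 ▸ hmono m.zero_le) (haM ▸ hmono hm)
  have hint (m : ℕ) (hm : m < M) : IntervalIntegrable f MeasureTheory.volume (a m) (a (m + 1)) := by
    refine hf.mono_set ?_
    rw [Set.uIcc_of_le (hmono m.le_succ), Set.uIcc_of_le (by norm_num)]
    exact hsub m hm
  have hsum := intervalIntegral.sum_integral_adjacent_intervals (n := M) hint
  rw [ha0, haM] at hsum
  have hcell : ∀ m ∈ Finset.range M,
      |(∫ t in a m..a (m + 1), f t) - 2 / M * f (-1 + δ + 2 * m / M)| ≤
        L * ((2 / M) ^ 2 / 2) + if m ∈ S then 2 * (2 / (M : ℝ)) else 0 := by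
    intro m hm
    rw [Finset.mem_range] at hm
    have h1 : a m ≤ -1 + δ + 2 * m / M := by simp only [ha]; linarith
    have h2 : -1 + δ + 2 * m / M ≤ a (m + 1) := by
      have := hstep m
      simp only [ha] at this ⊢; linarith
    rw [← hstep m]
    split_ifs with hS
    · refine (abs_integral_sub_le_of_bounded h1 h2 (hint m hm)
        fun t ht => hf1 t (hsub m hm ht)).trans ?_
      have : 0 ≤ L * ((a (m + 1) - a m) ^ 2 / 2) := by positivity
      linarith
    · rw [add_zero]
      refine abs_integral_sub_le_of_lipschitz hL h1 h2 (hint m hm) fun t ht => h m hm hS t ?_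
      simpa [ha] using ht
  have heq : 1 / 2 * (∫ t in (-1 : ℝ)..1, f t) -
      1 / M * ∑ m ∈ Finset.range M, f (-1 + δ + 2 * m / M) =
      1 / 2 * ∑ m ∈ Finset.range M,
        ((∫ t in a m..a (m + 1), f t) - 2 / M * f (-1 + δ + 2 * m / M)) := by
    rw [Finset.sum_sub_distrib, hsum, ← Finset.mul_sum]
    ring
  rw [heq, abs_mul, abs_of_pos (by norm_num : (0 : ℝ) < 1 / 2)]
  have hcard : ∑ m ∈ Finset.range M, (if m ∈ S then 2 * (2 / (M : ℝ)) else 0) ≤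
      S.card * (2 * (2 / (M : ℝ))) := by
    rw [← Finset.sum_filter, Finset.sum_const, nsmul_eq_mul]
    gcongr
    exact fun x hx => (Finset.mem_filter.1 hx).2
  have hbound := (Finset.abs_sum_le_sum_abs _ _).trans (Finset.sum_le_sum hcell)
  rw [Finset.sum_add_distrib, Finset.sum_const, Finset.card_range, nsmul_eq_mul] at hbound
  calc _ ≤ 1 / 2 * (M * (L * ((2 / M) ^ 2 / 2)) + S.card * (2 * (2 / (M : ℝ)))) := by
        gcongr; linarith
    _ = (L + 2 * (S.card : ℝ)) / M := by field_simp

theorem abs_pow_sub_pow_le_of_abs_le_one_s8 {x y : ℝ} (hx : |x| ≤ 1) (hy : |y| ≤ 1) (n : ℕ) :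
    |x ^ n - y ^ n| ≤ n * |x - y| := by
  refine (abs_pow_sub_pow_le x y n).trans ?_
  have : max |x| |y| ^ (n - 1) ≤ 1 :=
    pow_le_one₀ (le_max_of_le_left (abs_nonneg _)) (max_le hx hy)
  calc |x - y| * n * max |x| |y| ^ (n - 1) ≤ |x - y| * n * 1 := by gcongr
    _ = n * |x - y| := by ring

theorem abs_pow_mul_pow_le_one {x y : ℝ} (hx : |x| ≤ 1) (hy : |y| ≤ 1) (k l : ℕ) :
    |x ^ k * y ^ l| ≤ 1 := by
  rw [abs_mul, abs_pow, abs_pow]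
  exact mul_le_one₀ (pow_le_one₀ (abs_nonneg _) hx) (by positivity)
    (pow_le_one₀ (abs_nonneg _) hy)

theorem abs_pow_mul_pow_sub_le_s8 {u u' x x' : ℝ} (hu : |u| ≤ 1) (hu' : |u'| ≤ 1) (hx : |x| ≤ 1)
    (hx' : |x'| ≤ 1) (k l : ℕ) :
    |u ^ k * x ^ l - u' ^ k * x' ^ l| ≤ k * |u - u'| + l * |x - x'| := by
  have h1 : |x ^ l| ≤ 1 := by simpa using abs_pow_mul_pow_le_one hx hx l 0
  have h2 : |u' ^ k| ≤ 1 := by simpa using abs_pow_mul_pow_le_one hu' hu' k 0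
  calc |u ^ k * x ^ l - u' ^ k * x' ^ l|
      = |(u ^ k - u' ^ k) * x ^ l + u' ^ k * (x ^ l - x' ^ l)| := by ring_nf
    _ ≤ |u ^ k - u' ^ k| * |x ^ l| + |u' ^ k| * |x ^ l - x' ^ l| := by
        rw [← abs_mul, ← abs_mul]; exact abs_add_le _ _
    _ ≤ |u ^ k - u' ^ k| * 1 + 1 * |x ^ l - x' ^ l| := by gcongr
    _ ≤ k * |u - u'| + l * |x - x'| := by
        rw [mul_one, one_mul]
        exact add_le_add (abs_pow_sub_pow_le_of_abs_le_one_s8 hu hu' k)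
          (abs_pow_sub_pow_le_of_abs_le_one_s8 hx hx' l)

/-- Collocation error for the monomials. -/
theorem abs_collocation_error_pow_le {M : ℕ} (hM : 0 < M) {δ : ℝ} (hδ0 : 0 ≤ δ)
    (hδ : δ ≤ 2 / M) (n : ℕ) :
    |1 / 2 * (∫ t in (-1 : ℝ)..1, t ^ n) - 1 / M * ∑ m ∈ Finset.range M, (-1 + δ + 2 * m / M) ^ n| ≤
      (n : ℝ) / M := by
  have hM' : (0 : ℝ) < M := by exact_mod_cast hM
  have key := abs_collocation_error_le (f := fun t => t ^ n) hM hδ0 hδ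
    ((continuous_pow n).intervalIntegrable _ _)
    (fun t ht => by simpa using abs_pow_mul_pow_le_one (abs_le.2 ht) (abs_le.2 ht) n 0)
    (L := n) (by positivity) ∅ (fun m hm _ t ht => ?_)
  · simpa using key
  · have h1 : (0 : ℝ) ≤ 2 * m / M := by positivity
    have h2 : 2 * ((m : ℝ) + 1) / M ≤ 2 := by
      rw [div_le_iff₀ hM']
      have : (m : ℝ) + 1 ≤ M := by exact_mod_cast hm
      linarith
    have h3 : 2 * ((m : ℝ) + 1) / M = 2 * m / M + 2 / M := by ring
    exact abs_pow_sub_pow_le_of_abs_le_one_s8 (abs_le.2 ⟨by linarith [ht.1], by linarith [ht.2]⟩)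
      (abs_le.2 ⟨by linarith, by linarith⟩) n

theorem exists_mem_Ico_of_partition {c : ℕ → ℝ} {d : ℕ} {x : ℝ} (h0 : c 0 ≤ x) (hd : x < c d) :
    ∃ ℓ < d, x ∈ Set.Ico (c ℓ) (c (ℓ + 1)) := by
  classical
  have hex : ∃ i, x < c i := ⟨d, hd⟩
  have hpos : Nat.find hex ≠ 0 := fun h => (h ▸ Nat.find_spec hex).not_ge h0
  obtain ⟨ℓ, hℓ⟩ := Nat.exists_eq_succ_of_ne_zero hpos
  have h1 : ℓ < Nat.find hex := by omega
  refine ⟨ℓ, h1.trans_le (Nat.find_min' hex hd), not_lt.1 (Nat.find_min hex h1), ?_⟩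
  have := Nat.find_spec hex
  rwa [hℓ] at this

/-- All cells except at most `d` of them lie, together with an interior node, in one branch. -/
theorem exists_exceptional_cells {d : ℕ} {c : ℕ → ℝ} (hc0 : c 0 = -1) (hcd : c d = 1) (hd : 0 < d)
    {M : ℕ} (hM : 0 < M) {δ : ℝ} (hδ0 : 0 ≤ δ) (hδ : δ ≤ 2 / M)
    (hnodes : ∀ m < M, (-1 + δ + 2 * (m : ℝ) / M) ∉ c '' Set.Ioo 0 d) :
    ∃ S : Finset ℕ, S.card ≤ d ∧ ∀ m < M, m ∉ S → ∃ ℓ < d,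
      (-1 + δ + 2 * (m : ℝ) / M) ∈ Set.Ioo (c ℓ) (c (ℓ + 1)) ∧
      Set.Ioo (-1 + 2 * (m : ℝ) / M) (-1 + 2 * ((m : ℝ) + 1) / M) ⊆
        Set.Ioo (c ℓ) (c (ℓ + 1)) := by
  classical
  have hM' : (0 : ℝ) < M := by exact_mod_cast hM
  let g : ℕ → ℕ := fun i =>
    if i = 0 then (if δ = 0 then 0 else M - 1) else ⌊(c i + 1) * M / 2⌋₊
  refine ⟨(Finset.range d).image g, Finset.card_image_le.trans (by simp), fun m hm hmS => ?_⟩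
  have hg (i : ℕ) (hi : i < d) : g i ≠ m := fun h =>
    hmS (Finset.mem_image.2 ⟨i, Finset.mem_range.2 hi, h⟩)
  have hfloor (i : ℕ) (hi0 : i ≠ 0) (hi : i < d) (h1 : -1 + 2 * (m : ℝ) / M ≤ c i)
      (h2 : c i < -1 + 2 * ((m : ℝ) + 1) / M) : False := by
    refine hg i hi ?_
    simp only [g, if_neg hi0]
    have h3 : 2 * (m : ℝ) / M ≤ c i + 1 := by linarith
    have h4 : c i + 1 < 2 * ((m : ℝ) + 1) / M := by linarith
    rw [div_le_iff₀ hM'] at h3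
    rw [lt_div_iff₀ hM'] at h4
    rw [Nat.floor_eq_iff (by have := m.cast_nonneg (α := ℝ); linarith)]
    constructor <;> linarith
  have hm1 : (m : ℝ) + 1 ≤ M := by exact_mod_cast hm
  have hm0 : (0 : ℝ) ≤ 2 * m / M := by positivity
  have hstep : 2 * ((m : ℝ) + 1) / M = 2 * m / M + 2 / M := by ring
  have hright : 2 * ((m : ℝ) + 1) / M ≤ 2 := by rw [div_le_iff₀ hM']; linarith
  have hne1 : -1 + δ + 2 * (m : ℝ) / M ≠ -1 := fun h => by
    have h1 : δ = 0 := by linarith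
    have h2 : 2 * (m : ℝ) / M = 0 := by linarith
    have h3 : m = 0 := by simpa [hM.ne'] using h2
    exact hg 0 hd (by simp [g, h1, h3])
  have hne2 : -1 + δ + 2 * (m : ℝ) / M ≠ 1 := fun h => by
    have h2 : 2 * ((m : ℝ) + 1) / M = 2 := by linarith
    rw [div_eq_iff hM'.ne'] at h2
    have h3 : m + 1 = M := by
      have : (m : ℝ) + 1 = M := by linarith
      exact_mod_cast this
    have h4 : δ ≠ 0 := by
      have : 0 < 2 / (M : ℝ) := by positivity
      intro h0
      linarith
    exact hg 0 hd (by simp [g, h4]; omega)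
  have hlt : -1 + δ + 2 * (m : ℝ) / M < 1 := lt_of_le_of_ne (by linarith) hne2
  obtain ⟨ℓ, hℓ, hx1, hx2⟩ := exists_mem_Ico_of_partition (c := c) (d := d)
    (x := -1 + δ + 2 * (m : ℝ) / M) (by linarith) (by linarith)
  have hx1' : c ℓ ≠ -1 + δ + 2 * (m : ℝ) / M := fun h => by
    rcases Nat.eq_zero_or_pos ℓ with rfl | hpos
    · exact hne1 (by rw [← h, hc0])
    · exact hnodes m hm ⟨ℓ, ⟨hpos, hℓ⟩, h⟩
  have hx1 := lt_of_le_of_ne hx1 hx1'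
  refine ⟨ℓ, hℓ, ⟨hx1, hx2⟩, Set.Ioo_subset_Ioo ?_ ?_⟩
  · by_contra! h
    have : ℓ ≠ 0 := by rintro rfl; linarith
    exact hfloor ℓ this hℓ h.le (by linarith)
  · by_contra! h
    have : ℓ + 1 ≠ d := by rintro rfl; linarith
    exact hfloor (ℓ + 1) (by omega) (by omega) (by linarith) h

theorem partition_monotone {d : ℕ} {c : ℕ → ℝ} (hc : ∀ i < d, c i < c (i + 1)) ⦃i j : ℕ⦄
    (hij : i ≤ j) (hj : j ≤ d) : c i ≤ c j := by
  induction j, hij using Nat.le_induction with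
  | base => exact le_rfl
  | succ j _ ih => exact (ih (by omega)).trans (hc j (by omega)).le

theorem lipschitz_of_full_branch {d : ℕ} {c : ℕ → ℝ}
    (hc0 : c 0 = -1) (hcd : c d = 1) (hc : ∀ i < d, c i < c (i + 1)) {T : ℝ → ℝ}
    (hTan : ∀ ℓ < d, AnalyticOnNhd ℝ T (Set.Ioo (c ℓ) (c (ℓ + 1)))) {K : ℝ}
    (hK : ∀ x ∈ Set.Icc (-1 : ℝ) 1 \ (c '' Set.Ioo 0 d), |deriv T x| ≤ K)
    {ℓ : ℕ} (hℓ : ℓ < d) {s t : ℝ} (hs : s ∈ Set.Ioo (c ℓ) (c (ℓ + 1)))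
    (ht : t ∈ Set.Ioo (c ℓ) (c (ℓ + 1))) : |T t - T s| ≤ K * |t - s| := by
  have hmono := partition_monotone hc
  refine (convex_Ioo (c ℓ) (c (ℓ + 1))).norm_image_sub_le_of_norm_deriv_le (f := T)
    (fun x hx => ((hTan ℓ hℓ) x hx).differentiableAt) (fun x hx => hK x ⟨?_, ?_⟩) hs ht
  · have h1 := hmono ℓ.zero_le hℓ.le
    have h2 := hmono (Nat.succ_le_of_lt hℓ) le_rfl
    exact ⟨by linarith [hx.1], by linarith [hx.2]⟩
  · rintro ⟨i, ⟨-, hi⟩, rfl⟩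
    rcases Nat.lt_or_ge ℓ i with h | h
    · exact hx.2.not_ge (hmono (Nat.succ_le_of_lt h) hi.le)
    · exact hx.1.not_ge (hmono h hℓ.le)

/-- The derivative bound of a full branch map is at least one. -/
theorem one_le_of_lipschitz_of_surjOn {T : ℝ → ℝ} {a b K : ℝ} (hab : b - a ≤ 2)
    (hT : Set.SurjOn T (Set.Ioo a b) (Set.Ioo (-1 : ℝ) 1))
    (hLip : ∀ s ∈ Set.Ioo a b, ∀ t ∈ Set.Ioo a b, |T t - T s| ≤ K * |t - s|) : 1 ≤ K := by
  have hK0 : 0 ≤ K := by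
    obtain ⟨s, hs, hs'⟩ := hT (show (0 : ℝ) ∈ Set.Ioo (-1 : ℝ) 1 by norm_num)
    obtain ⟨t, ht, ht'⟩ := hT (show (1 / 2 : ℝ) ∈ Set.Ioo (-1 : ℝ) 1 by norm_num)
    by_contra! hneg
    have h := hLip s hs t ht
    rw [hs', ht'] at h
    have := mul_nonpos_of_nonpos_of_nonneg hneg.le (abs_nonneg (t - s))
    norm_num at h
    linarith
  by_contra! hlt
  obtain ⟨s, hs, hs'⟩ := hT (show -((1 + K) / 2) ∈ Set.Ioo (-1 : ℝ) 1 from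
    ⟨by linarith, by linarith⟩)
  obtain ⟨t, ht, ht'⟩ := hT (show (1 + K) / 2 ∈ Set.Ioo (-1 : ℝ) 1 from
    ⟨by linarith, by linarith⟩)
  have h := (le_abs_self _).trans (hLip s hs t ht)
  rw [hs', ht'] at h
  have hst : |t - s| ≤ 2 := abs_le.2 ⟨by linarith [hs.2, ht.1], by linarith [hs.1, ht.2]⟩
  have := mul_le_mul_of_nonneg_left hst hK0
  linarith

theorem intervalIntegrable_pow_mul_pow_of_branches {d : ℕ} {c : ℕ → ℝ}
    (hc0 : c 0 = -1) (hcd : c d = 1) (hc : ∀ i < d, c i < c (i + 1)) {T : ℝ → ℝ}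
    (hT : Set.MapsTo T (Set.Icc (-1 : ℝ) 1) (Set.Icc (-1 : ℝ) 1))
    (hTc : ∀ ℓ < d, ContinuousOn T (Set.Ioo (c ℓ) (c (ℓ + 1)))) (k l : ℕ) :
    IntervalIntegrable (fun t => T t ^ k * t ^ l) MeasureTheory.volume (-1) 1 := by
  have hmono := partition_monotone hc
  rw [← hc0, ← hcd]
  refine IntervalIntegrable.trans_iterate fun ℓ hℓ => ?_
  rw [intervalIntegrable_iff_integrableOn_Ioo_of_le (hc ℓ hℓ).le]
  refine MeasureTheory.IntegrableOn.of_bound (C := 1) (by simp)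
    ((((hTc ℓ hℓ).pow k).mul (continuous_pow l).continuousOn).aestronglyMeasurable measurableSet_Ioo) ?_
  refine MeasureTheory.ae_restrict_of_forall_mem measurableSet_Ioo fun t ht => ?_
  have h1 := hmono ℓ.zero_le hℓ.le
  have h2 := hmono (Nat.succ_le_of_lt hℓ) le_rfl
  have ht' : t ∈ Set.Icc (-1 : ℝ) 1 := ⟨by linarith [ht.1], by linarith [ht.2]⟩
  exact abs_pow_mul_pow_le_one (abs_le.2 (hT ht')) (abs_le.2 ht') k l


/-- Spectral-norm collocation error bounds for the `N × N` EDMD matrices built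
from monomial observables and equidistant nodes, for an analytic full branch map
`T` on `[-1,1]` (Proposition 7 of the paper). -/
theorem edmd_matrices_spectral_norm_collocation_error
    (d : ℕ) (hd : 0 < d) (c : ℕ → ℝ)
    (hc0 : c 0 = -1) (hcd : c d = 1) (hc : ∀ i < d, c i < c (i + 1))
    (T : ℝ → ℝ)
    (hT : Set.MapsTo T (Set.Icc (-1 : ℝ) 1) (Set.Icc (-1 : ℝ) 1))
    (hTan : ∀ ℓ < d, AnalyticOnNhd ℝ T (Set.Ioo (c ℓ) (c (ℓ + 1))))
    (hTbij : ∀ ℓ < d, Set.BijOn T (Set.Ioo (c ℓ) (c (ℓ + 1))) (Set.Ioo (-1 : ℝ) 1))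
    (K : ℝ)
    (hK : ∀ x ∈ Set.Icc (-1 : ℝ) 1 \ (c '' Set.Ioo 0 d), |deriv T x| ≤ K)
    (M : ℕ) (hM : 0 < M) (δ : ℝ) (hδ0 : 0 ≤ δ) (hδ : δ ≤ 2 / M)
    (hnodes : ∀ m < M, (-1 + δ + 2 * (m : ℝ) / M) ∉ c '' Set.Ioo 0 d)
    (N : ℕ) :
    (∀ v : EuclideanSpace ℝ (Fin N),
      ‖Matrix.toEuclideanLin
          (Matrix.of fun k l : Fin N =>
            1 / 2 * (∫ x in (-1 : ℝ)..1, x ^ ((k : ℕ) + (l : ℕ))) -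
              1 / M * ∑ m ∈ Finset.range M,
                (-1 + δ + 2 * m / M) ^ ((k : ℕ) + (l : ℕ))) v‖ ≤
        3 / 2 * N ^ 2 / M * ‖v‖) ∧
    (∀ v : EuclideanSpace ℝ (Fin N),
      ‖Matrix.toEuclideanLin
          (Matrix.of fun k l : Fin N =>
            1 / 2 * (∫ x in (-1 : ℝ)..1, T x ^ (k : ℕ) * x ^ (l : ℕ)) -
              1 / M * ∑ m ∈ Finset.range M,
                T (-1 + δ + 2 * m / M) ^ (k : ℕ) * (-1 + δ + 2 * m / M) ^ (l : ℕ)) v‖ ≤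
        3 / 2 * max K (2 * ((d : ℝ) - 1)) * N ^ 2 / M * ‖v‖) := by
  have hM' : (0 : ℝ) < M := by exact_mod_cast hM
  have hLip {ℓ : ℕ} (hℓ : ℓ < d) {s t : ℝ} (hs : s ∈ Set.Ioo (c ℓ) (c (ℓ + 1)))
      (ht : t ∈ Set.Ioo (c ℓ) (c (ℓ + 1))) : |T t - T s| ≤ K * |t - s| :=
    lipschitz_of_full_branch hc0 hcd hc hTan hK hℓ hs ht
  have hmono := partition_monotone hc
  have hK1 : 1 ≤ K := by
    refine one_le_of_lipschitz_of_surjOn ?_ (hTbij 0 hd).surjOn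
      fun s hs t ht => hLip hd hs ht
    have := hmono (Nat.succ_le_of_lt hd) le_rfl
    linarith
  set K' := max K (2 * ((d : ℝ) - 1)) with hK'
  have hKK' : K ≤ K' := le_max_left _ _
  have hdK' : 2 * ((d : ℝ) - 1) ≤ K' := le_max_right _ _
  have hK'1 : 1 ≤ K' := hK1.trans hKK'
  have hHentry := abs_collocation_error_pow_le hM hδ0 hδ
  constructor
  · intro v
    refine (norm_toEuclideanLin_le_of_errorWeight (C := 1 / M) _ (by positivity)
      (fun k l => (hHentry _).trans ?_) v).trans_eq (by ring)
    rw [div_mul_eq_mul_div, one_mul]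
    gcongr
    unfold errorWeight
    split_ifs with h
    · simp [h]
    · push_cast; linarith
  · intro v
    refine (norm_toEuclideanLin_le_of_errorWeight (C := K' / M) _ (by positivity)
      (fun k l => ?_) v).trans_eq (by ring)
    rw [Matrix.of_apply]
    unfold errorWeight
    split_ifs with h
    · simp only [h, pow_zero, one_mul]
      refine (hHentry l).trans ?_
      rw [div_mul_eq_mul_div]
      gcongr
      exact le_mul_of_one_le_left (Nat.cast_nonneg _) hK'1
    · obtain ⟨S, hScard, hS⟩ := exists_exceptional_cells hc0 hcd hd hM hδ0 hδ hnodes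
      have habs {t : ℝ} (ht : t ∈ Set.Icc (-1 : ℝ) 1) : |T t| ≤ 1 := abs_le.2 (hT ht)
      have key := abs_collocation_error_le (f := fun t => T t ^ (k : ℕ) * t ^ (l : ℕ)) hM hδ0 hδ
        (intervalIntegrable_pow_mul_pow_of_branches hc0 hcd hc hT
          (fun ℓ hℓ => (hTan ℓ hℓ).continuousOn) k l)
        (fun t ht => abs_pow_mul_pow_le_one (habs ht) (abs_le.2 ht) k l)
        (L := k * K + l) (by positivity) S (fun m hm hmS t ht => ?_)
      · refine key.trans ?_
        rw [div_mul_eq_mul_div]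
        gcongr
        have h1 : (S.card : ℝ) ≤ d := by exact_mod_cast hScard
        have h2 : (k : ℝ) * K ≤ k * K' := by gcongr
        have h3 : (l : ℝ) ≤ K' * l := le_mul_of_one_le_left (Nat.cast_nonneg _) hK'1
        have h4 : 2 * (d : ℝ) ≤ 2 * K' := by
          rcases Nat.lt_or_ge 1 d with hd2 | hd1
          · have : (2 : ℝ) ≤ d := by exact_mod_cast hd2
            linarith
          · have : (d : ℝ) ≤ 1 := by exact_mod_cast hd1
            linarith
        linarith
      · obtain ⟨ℓ, hℓ, hx, hsub⟩ := hS m hm hmS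
        have hIcc {s : ℝ} (hs : s ∈ Set.Ioo (c ℓ) (c (ℓ + 1))) : s ∈ Set.Icc (-1 : ℝ) 1 := by
          have h1 := hmono ℓ.zero_le hℓ.le
          have h2 := hmono (Nat.succ_le_of_lt hℓ) le_rfl
          exact ⟨by linarith [hs.1], by linarith [hs.2]⟩
        refine (abs_pow_mul_pow_sub_le_s8 (habs (hIcc (hsub ht))) (habs (hIcc hx))
          (abs_le.2 (hIcc (hsub ht))) (abs_le.2 (hIcc hx)) k l).trans ?_
        have := mul_le_mul_of_nonneg_left (hLip hℓ hx (hsub ht)) (Nat.cast_nonneg (α := ℝ) k)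
        linarith
end
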